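/- arXiv:2111.15237 — 5 statements merged into one kernel-verified Lean document; each statement's English description precedes it below -/
import Mathlib

section
/- Let A be a finite-dimensional simple algebra over a field F. If an element c ∈ A satisfies cA ⊆ [A,A] (that is, cx ∈ [A,A] for every x ∈ A), then c = 0. -/
open scoped TensorProduct

/-- A nontrivial finite-dimensional algebra over an algebraically closed field carries a nonzero
linear functional vanishing on commutators: the trace of a matrix block of its semisimple
quotient. -/
theorem exists_ne_zero_linearMap_mul_comm_of_isAlgClosed (L B : Type*) [Field L] [IsAlgClosed L]
    [Ring B] [Nontrivial B] [Algebra L B] [FiniteDimensional L B] :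
    ∃ φ : B →ₗ[L] L, φ ≠ 0 ∧ ∀ x y, φ (x * y) = φ (y * x) := by
  have : IsArtinianRing B := IsArtinianRing.of_finite L B
  have : IsSemisimpleRing (B ⧸ Ring.jacobson B) := IsSemiprimaryRing.isSemisimpleRing
  have : Nontrivial (B ⧸ Ring.jacobson B) :=
    Submodule.Quotient.nontrivial_iff.mpr (Ring.jacobson_lt_top B).ne
  have : FiniteDimensional L (B ⧸ Ring.jacobson B) :=
    Module.Finite.of_surjective (Ideal.Quotient.mkₐ L (Ring.jacobson B)).toLinearMap
      (Ideal.Quotient.mkₐ_surjective L _)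
  obtain ⟨n, d, hd, ⟨e⟩⟩ :=
    IsSemisimpleRing.exists_algEquiv_pi_matrix_of_isAlgClosed L (B ⧸ Ring.jacobson B)
  have : Nonempty (Fin n) := by
    by_contra hn
    rw [not_nonempty_iff] at hn
    exact not_subsingleton _ e.toEquiv.subsingleton
  let i : Fin n := Classical.arbitrary _
  have := hd i
  let f : B →ₐ[L] Matrix (Fin (d i)) (Fin (d i)) L :=
    ((Pi.evalAlgHom L _ i).comp e.toAlgHom).comp (Ideal.Quotient.mkₐ L (Ring.jacobson B))
  have hf : Function.Surjective f :=
    ((Function.surjective_eval i).comp e.surjective).comp (Ideal.Quotient.mkₐ_surjective L _)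
  refine ⟨Matrix.traceLinearMap (Fin (d i)) L L ∘ₗ f.toLinearMap, fun h => ?_, fun x y => ?_⟩
  · obtain ⟨b, hb⟩ := hf (Matrix.single 0 0 1)
    simpa [hb] using LinearMap.congr_fun h b
  · simpa using Matrix.trace_mul_comm (f x) (f y)

/-- A nontrivial finite-dimensional algebra over a field `F` carries a nonzero `F`-linear map to
the algebraic closure of `F` vanishing on commutators. -/
theorem exists_ne_zero_linearMap_mul_comm (F A : Type*) [Field F] [Ring A] [Nontrivial A]
    [Algebra F A] [FiniteDimensional F A] :
    ∃ φ : A →ₗ[F] AlgebraicClosure F, φ ≠ 0 ∧ ∀ x y, φ (x * y) = φ (y * x) := by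
  obtain ⟨φ, hφ, hcomm⟩ := exists_ne_zero_linearMap_mul_comm_of_isAlgClosed
    (AlgebraicClosure F) (AlgebraicClosure F ⊗[F] A)
  refine ⟨φ.restrictScalars F ∘ₗ
    (Algebra.TensorProduct.includeRight : A →ₐ[F] AlgebraicClosure F ⊗[F] A).toLinearMap,
    fun h => hφ ?_, fun x y => ?_⟩
  · ext a
    simpa using LinearMap.congr_fun h a
  · simpa using hcomm (1 ⊗ₜ x) (1 ⊗ₜ y)

/-- **Lemma 2.1.** Let `A` be a finite-dimensional simple algebra over a field `F`.
If `c ∈ A` satisfies `c * x ∈ [A,A]` (the linear span of commutators) for every `x ∈ A`,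
then `c = 0`. -/
theorem cube_lemma_simple (F A : Type*) [Field F] [Ring A] [Algebra F A]
    [FiniteDimensional F A] [IsSimpleRing A] (c : A)
    (h : ∀ x : A, c * x ∈ Submodule.span F {z : A | ∃ u v : A, z = u * v - v * u}) :
    c = 0 := by
  obtain ⟨φ, hφ, hcomm⟩ := exists_ne_zero_linearMap_mul_comm F A
  have hc : ∀ x, φ (c * x) = 0 := by
    have hspan : Submodule.span F {z : A | ∃ u v : A, z = u * v - v * u} ≤ LinearMap.ker φ := by
      rw [Submodule.span_le]
      rintro _ ⟨u, v, rfl⟩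
      simp [hcomm u v]
    exact fun x => hspan (h x)
  let I : TwoSidedIdeal A := .mk' {a | ∀ x, φ (a * x) = 0}
    (by simp) (fun ha hb x => by simp [add_mul, ha x, hb x]) (fun ha x => by simp [ha x])
    (fun {a b} hb x => by rw [mul_assoc, hcomm, mul_assoc, hb])
    (fun {a b} ha x => by rw [mul_assoc, ha])
  by_contra hne
  have h1 : (1 : A) ∈ I :=
    IsSimpleRing.one_mem_of_ne_zero_mem I hne ((TwoSidedIdeal.mem_mk' ..).mpr hc)
  refine hφ (LinearMap.ext fun x => ?_)
  simpa using (TwoSidedIdeal.mem_mk' ..).mp h1 x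
end

section
/- Let A be a finite-dimensional algebra over a field F with char(F) ≠ 2. If a linear map D : A → A satisfies xD(x)x ∈ [A,A] for every x ∈ A, then D is the sum of an inner derivation of A and a linear map from A whose image is contained in rad(A); that is, there exist a ∈ A and a linear map N : A → A with N(A) ⊆ rad(A) such that D(x) = ax − xa + N(x) for all x ∈ A. -/
/-- The radical of a finite-dimensional algebra, realized as the intersection of all
maximal two-sided ideals. -/
noncomputable def ringRad (A : Type*) [Ring A] : TwoSidedIdeal A :=
  sInf {M : TwoSidedIdeal A | IsCoatom M}

open TensorProduct in
theorem isSimpleRing_tensorProduct (K L B : Type*) [Field K] [Field L] [Algebra K L]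
    [Ring B] [Algebra K B] [Algebra.IsCentral K B] [IsSimpleRing B] : IsSimpleRing (L ⊗[K] B) := by
  classical
  have : Nontrivial (L ⊗[K] B) := inferInstance
  refine .of_eq_bot_or_eq_top fun I ↦ or_iff_not_imp_left.2 fun hI ↦ ?_
  let 𝓑 := Module.Basis.ofVectorSpace K L
  let φ := TensorProduct.equivFinsuppOfBasisLeft (N := B) 𝓑
  have hφ (x : L) (y : B) (i) : φ (x ⊗ₜ y) i = 𝓑.repr x i • y :=
    TensorProduct.equivFinsuppOfBasisLeft_apply_tmul_apply ..
  have hleft (u : B) (t : L ⊗[K] B) (i) : φ ((1 ⊗ₜ u) * t) i = u * φ t i := by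
    induction t with
    | zero => simp
    | tmul x y => simp [hφ]
    | add a b ha hb => simp [mul_add, ha, hb]
  have hright (u : B) (t : L ⊗[K] B) (i) : φ (t * (1 ⊗ₜ u)) i = φ t i * u := by
    induction t with
    | zero => simp
    | tmul x y => simp [hφ]
    | add a b ha hb => simp [add_mul, ha, hb]
  obtain ⟨t₀, ht₀, ht₀0⟩ := SetLike.exists_of_lt (bot_lt_iff_ne_bot.2 hI)
  obtain ⟨t, ⟨htI, ht0⟩, hmin⟩ := (measure fun t : L ⊗[K] B ↦ (φ t).support.card).wf.has_min
    {t | t ∈ I ∧ t ≠ 0} ⟨t₀, ht₀, ht₀0⟩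
  have hmin (s : L ⊗[K] B) (hs : s ∈ I) (hlt : (φ s).support.card < (φ t).support.card) :
      s = 0 := by
    by_contra hs0
    exact hmin s ⟨hs, hs0⟩ hlt
  obtain ⟨i₀, hi₀⟩ : ∃ i, φ t i ≠ 0 := by
    by_contra! h
    exact ht0 (φ.map_eq_zero_iff.1 (Finsupp.ext h))
  let J : TwoSidedIdeal B := .mk'
    {c | ∃ s ∈ I, φ s i₀ = c ∧ ∀ i, φ t i = 0 → φ s i = 0}
    ⟨0, I.zero_mem, by simp, by simp⟩
    (by
      rintro _ _ ⟨s, hs, rfl, h⟩ ⟨s', hs', rfl, h'⟩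
      exact ⟨s + s', I.add_mem hs hs', by simp, fun i hi ↦ by simp [h i hi, h' i hi]⟩)
    (by
      rintro _ ⟨s, hs, rfl, h⟩
      exact ⟨-s, I.neg_mem hs, by simp, fun i hi ↦ by simp [h i hi]⟩)
    (by
      rintro u _ ⟨s, hs, rfl, h⟩
      exact ⟨(1 ⊗ₜ u) * s, I.mul_mem_left _ _ hs, hleft .., fun i hi ↦ by simp [hleft, h i hi]⟩)
    (by
      rintro _ u ⟨s, hs, rfl, h⟩
      exact ⟨s * (1 ⊗ₜ u), I.mul_mem_right _ _ hs, hright .., fun i hi ↦ by simp [hright, h i hi]⟩)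
  obtain ⟨s, hsI, hs1, hs⟩ : (1 : B) ∈ {c | ∃ s ∈ I, φ s i₀ = c ∧ ∀ i, φ t i = 0 → φ s i = 0} := by
    have h1 := IsSimpleRing.one_mem_of_ne_zero_mem J hi₀
      (by rw [TwoSidedIdeal.mem_mk']; exact ⟨t, htI, rfl, fun i hi ↦ hi⟩)
    rwa [TwoSidedIdeal.mem_mk'] at h1
  have hcomm (u : B) (i) : u * φ s i = φ s i * u := by
    have h0 := hmin ((1 ⊗ₜ u) * s - s * (1 ⊗ₜ u))
      (I.sub_mem (I.mul_mem_left _ _ hsI) (I.mul_mem_right _ _ hsI)) (by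
        refine Finset.card_lt_card ((Finset.ssubset_iff_of_subset ?_).2 ⟨i₀, by simpa using hi₀, ?_⟩)
        · intro i hi
          contrapose! hi
          simp only [Finsupp.notMem_support_iff] at hi ⊢
          simp [hleft, hright, hs i hi]
        · simp [hleft, hright, hs1])
    have := congrArg (fun z ↦ φ z i) h0
    simpa [hleft, hright, sub_eq_zero] using this
  have hk (i) : ∃ k : K, φ s i = algebraMap K B k := by
    rw [← Algebra.IsCentral.mem_center_iff, Subalgebra.mem_center_iff]
    exact fun u ↦ hcomm u i
  choose k hk using hk
  have hsl : s = (∑ i ∈ (φ s).support, k i • 𝓑 i) ⊗ₜ 1 := by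
    conv_lhs => rw [← φ.symm_apply_apply s, TensorProduct.equivFinsuppOfBasisLeft_symm_apply]
    rw [Finsupp.sum, TensorProduct.sum_tmul]
    refine Finset.sum_congr rfl fun i _ ↦ ?_
    rw [hk, Algebra.algebraMap_eq_smul_one, TensorProduct.tmul_smul, TensorProduct.smul_tmul']
  set l := ∑ i ∈ (φ s).support, k i • 𝓑 i
  have hl : l ≠ 0 := by
    intro h
    rw [h, TensorProduct.zero_tmul] at hsl
    simp [hsl] at hs1
  rw [← I.one_mem_iff]
  have := I.mul_mem_left (l⁻¹ ⊗ₜ 1) _ hsI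
  rwa [hsl, Algebra.TensorProduct.tmul_mul_tmul, inv_mul_cancel₀ hl, one_mul,
    ← Algebra.TensorProduct.one_def] at this

theorem map_mul_mul_self_of_jordan {R : Type*} [Ring R] (h2 : ∀ x : R, 2 * x = 0 → x = 0)
    (E : R →+ R) (hE : ∀ x y, E (x * y + y * x) = E x * y + x * E y + E y * x + y * E x)
    (x y : R) : E (x * y * x) = E x * y * x + x * E y * x + x * y * E x := by
  have two (u : R) : E (2 * u) = 2 * E u := by simp [two_mul]
  have h1 := hE x (x * y + y * x)
  have h3 := hE (x * x) y
  have h4 := hE x x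
  have h5 : x * (x * y + y * x) + (x * y + y * x) * x =
    2 * (x * y * x) + (x * x * y + y * (x * x)) := by noncomm_ring
  rw [← two_mul, two] at h4
  rw [h5, map_add, two, h3, hE x y] at h1
  have h6 : E (x * x) = E x * x + x * E x := by
    rw [← sub_eq_zero]
    refine h2 _ ?_
    rw [mul_sub, h4]
    noncomm_ring
  rw [h6] at h1
  rw [← sub_eq_zero]
  refine h2 _ ?_
  rw [mul_sub, eq_sub_of_add_eq h1]
  noncomm_ring

theorem map_mul_mul_add_of_jordan {R : Type*} [Ring R] (h2 : ∀ x : R, 2 * x = 0 → x = 0)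
    (E : R →+ R) (hE : ∀ x y, E (x * y + y * x) = E x * y + x * E y + E y * x + y * E x)
    (x y z : R) :
    E (x * y * z + z * y * x) = E x * y * z + x * E y * z + x * y * E z +
      E z * y * x + z * E y * x + z * y * E x := by
  have key := map_mul_mul_self_of_jordan h2 E hE
  have h1 := key (x + z) y
  have h3 : (x + z) * y * (x + z) = x * y * x + z * y * z + (x * y * z + z * y * x) := by
    noncomm_ring
  rw [h3, map_add E (x * y * x + z * y * z), map_add E (x * y * x), key, key, map_add E x z] at h1
  rw [eq_sub_of_add_eq' h1]
  noncomm_ring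

theorem eq_zero_or_eq_zero_of_mul_mul_add_eq_zero {R : Type*} [Ring R]
    (h2 : ∀ x : R, 2 * x = 0 → x = 0)
    (hprime : ∀ a b : R, (∀ z, a * z * b = 0) → a = 0 ∨ b = 0) (a b : R)
    (h : ∀ z, a * z * b + b * z * a = 0) : a = 0 ∨ b = 0 := by
  refine hprime a b fun z ↦ ?_
  have key (w) : a * z * b * w * (a * z * b) = 0 := by
    refine h2 _ ?_
    have i1 : a * z * b * w * (a * z * b) = -(a * (z * a * w) * b * z * b) := by
      calc a * z * b * w * (a * z * b) = a * z * (b * w * a) * z * b := by noncomm_ring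
        _ = _ := by rw [eq_neg_of_add_eq_zero_right (h w)]; noncomm_ring
    have i2 : a * (z * a * w) * b * z * b = -(b * z * a * w * a * z * b) := by
      rw [eq_neg_of_add_eq_zero_left (h (z * a * w))]; noncomm_ring
    have i3 : b * z * a * w * a * z * b = -(a * z * b * w * (a * z * b)) := by
      rw [eq_neg_of_add_eq_zero_right (h z)]; noncomm_ring
    rw [two_mul]
    nth_rw 1 [i1]
    rw [i2, i3]
    noncomm_ring
  exact (hprime _ _ key).elim id id

/-- Herstein's theorem: Jordan derivations of `2`-torsion-free prime rings are derivations, under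
the assumption that the Leibniz rule holds when the first factor is central. -/
theorem map_mul_of_jordan {R : Type*} [Ring R] (h2 : ∀ x : R, 2 * x = 0 → x = 0)
    (hprime : ∀ a b : R, (∀ z, a * z * b = 0) → a = 0 ∨ b = 0) (E : R →+ R)
    (hE : ∀ x y, E (x * y + y * x) = E x * y + x * E y + E y * x + y * E x)
    (hcent : ∀ x, (∀ u, x * u = u * x) → ∀ y, E (x * y) = E x * y + x * E y) (x y : R) :
    E (x * y) = E x * y + x * E y := by
  let δ : R → R → R := fun x y ↦ E (x * y) - (E x * y + x * E y)
  have hδadd (x y z) : δ x (y + z) = δ x y + δ x z := by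
    simp only [δ, mul_add, map_add]; abel
  have hkey (x y z) : δ x y * z * (x * y - y * x) + (x * y - y * x) * z * δ x y = 0 := by
    have e : E (x * y * z * (y * x) + y * x * z * (x * y)) =
        E (x * (y * z * y) * x) + E (y * (x * z * x) * y) := by
      rw [← map_add]
      congr 1
      noncomm_ring
    have hyx : E (y * x) = E x * y + x * E y + E y * x + y * E x - E (x * y) := by
      rw [eq_sub_iff_add_eq', ← map_add, hE]
    rw [map_mul_mul_add_of_jordan h2 E hE, hyx] at e
    simp only [map_mul_mul_self_of_jordan h2 E hE] at e
    rw [← sub_eq_zero] at e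
    rw [← neg_eq_zero, ← e]
    simp only [δ]
    noncomm_ring
  have hor (x y) : δ x y = 0 ∨ x * y - y * x = 0 :=
    eq_zero_or_eq_zero_of_mul_mul_add_eq_zero h2 hprime _ _ (hkey x y)
  by_contra hne
  replace hne : δ x y ≠ 0 := fun h ↦ hne (sub_eq_zero.1 h)
  refine hne (sub_eq_zero.2 (hcent x (fun u ↦ ?_) y))
  rcases hor x u with hu | hu
  · have h3 : δ x (y + u) ≠ 0 := by rwa [hδadd, hu, add_zero]
    have h4 := (hor x (y + u)).resolve_left h3
    have h5 := (hor x y).resolve_left hne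
    rw [← sub_eq_zero, ← sub_eq_zero.2 (h4.trans h5.symm)]
    noncomm_ring
  · exact sub_eq_zero.1 hu

theorem Matrix.mul_mul_eq_zero {Ω n : Type*} [Field Ω] [Fintype n] [DecidableEq n]
    (a b : Matrix n n Ω) (h : ∀ z, a * z * b = 0) : a = 0 ∨ b = 0 := by
  by_contra! hab
  obtain ⟨ha, hb⟩ := hab
  obtain ⟨i, j, hij⟩ : ∃ i j, a i j ≠ 0 := by
    by_contra! h'; exact ha (Matrix.ext h')
  obtain ⟨k, l, hkl⟩ : ∃ i j, b i j ≠ 0 := by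
    by_contra! h'; exact hb (Matrix.ext h')
  have := congrFun (congrFun (h (Matrix.single j k 1)) i) l
  rw [Matrix.mul_assoc, Matrix.mul_apply] at this
  rw [Finset.sum_eq_single j] at this
  · simp_all
  · intro x _ hx
    simp [Matrix.single_mul_apply_of_ne _ _ _ _ _ hx]
  · simp

theorem Matrix.exists_eq_commutator_of_leibniz {Ω : Type*} [Field Ω] {n : ℕ} [NeZero n]
    (E : Matrix (Fin n) (Fin n) Ω →ₗ[Ω] Matrix (Fin n) (Fin n) Ω)
    (hE : ∀ x y, E (x * y) = E x * y + x * E y) : ∃ a, ∀ x, E x = a * x - x * a := by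
  let e (i j : Fin n) : Matrix (Fin n) (Fin n) Ω := Matrix.single i j 1
  refine ⟨∑ i, E (e i 0) * e 0 i, fun x ↦ ?_⟩
  have hone : ∑ i, e i 0 * e 0 i = 1 := by
    simp only [e, Matrix.single_mul_single_same, mul_one]
    exact Matrix.sum_single_one
  have hl (i) : x * e i 0 = ∑ k, x k i • e k 0 := by
    ext r s
    simp only [e, Matrix.sum_apply, Matrix.smul_apply, Matrix.single_apply]
    by_cases hs : s = 0
    · subst hs; simp
    · simp [hs, Ne.symm hs]
  have hr (k) : e 0 k * x = ∑ i, x k i • e 0 i := by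
    ext r s
    simp only [e, Matrix.sum_apply, Matrix.smul_apply, Matrix.single_apply]
    by_cases hs : r = 0
    · subst hs; simp
    · simp [hs, Ne.symm hs]
  have h1 : ∑ i, E (x * e i 0) * e 0 i = E x + x * ∑ i, E (e i 0) * e 0 i := by
    simp only [hE, add_mul, Finset.sum_add_distrib, Finset.mul_sum, mul_assoc]
    rw [← Finset.mul_sum, hone, mul_one]
  have h2 : ∑ i, E (x * e i 0) * e 0 i = (∑ i, E (e i 0) * e 0 i) * x := by
    simp only [Finset.sum_mul, mul_assoc, hr, hl, map_sum, map_smul, Finset.mul_sum, mul_smul_comm,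
      smul_mul_assoc]
    exact Finset.sum_comm
  rw [← h2, h1, add_sub_cancel_right]

theorem Matrix.mem_range_scalar_of_commute_idempotent {Ω n : Type*} [Field Ω] [Fintype n]
    [DecidableEq n] (b : Matrix n n Ω) (hb : ∀ e, e * e = e → e * b = b * e) :
    ∃ β : Ω, b = β • 1 := by
  have h : b ∈ Set.range (Matrix.scalar n) := by
    refine Matrix.mem_range_scalar_of_commute_single fun i j hij ↦ ?_
    have h1 := hb (Matrix.single i i 1) (by simp)
    have h2 := hb (Matrix.single i i 1 + Matrix.single i j 1) (by
      simp [add_mul, mul_add, Matrix.single_mul_single_of_ne _ _ _ _ hij.symm])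
    rw [add_mul, mul_add, h1] at h2
    exact add_left_cancel h2
  obtain ⟨β, rfl⟩ := h
  exact ⟨β, by rw [Matrix.scalar_apply, Matrix.smul_one_eq_diagonal]⟩

theorem commute_of_twisted_jordan {R : Type*} [Ring R] (h2 : ∀ x : R, 2 * x = 0 → x = 0)
    {b d e : R} (he : e * e = e)
    (h : 2 * (d + d) = 2 * (d * e + e * d + d * e + e * d) - ((e + e) * b + b * (e + e))) :
    e * b = b * e := by
  have he' (x : R) : e * (e * x) = e * x := by rw [← mul_assoc, he]
  rw [← sub_eq_zero] at h
  have e1 : e * b - e * b * e = 0 := h2 _ (by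
    have h1 := congrArg (fun x ↦ e * x * (1 - e)) h
    simp only [mul_zero, zero_mul] at h1
    rw [← h1]
    simp only [mul_add, mul_sub, add_mul, sub_mul, mul_assoc, two_mul, he, he', mul_one]
    abel)
  have e2 : b * e - e * b * e = 0 := h2 _ (by
    have h1 := congrArg (fun x ↦ (1 - e) * x * e) h
    simp only [mul_zero, zero_mul] at h1
    rw [← h1]
    simp only [mul_add, mul_sub, add_mul, sub_mul, mul_assoc, two_mul, he, he', one_mul]
    abel)
  rw [sub_eq_zero.1 e1, sub_eq_zero.1 e2]

/-- Structure of the linear maps on a matrix algebra satisfying a twisted Jordan identity. -/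
theorem Matrix.exists_eq_commutator_add_smul {Ω : Type*} [Field Ω] (h2 : (2 : Ω) ≠ 0) {n : ℕ}
    [NeZero n] (D : Matrix (Fin n) (Fin n) Ω →ₗ[Ω] Matrix (Fin n) (Fin n) Ω)
    (hD : ∀ x y, (2 : Ω) • D (x * y + y * x) = (2 : Ω) • (D x * y + x * D y + D y * x + y * D x) -
      ((x * y + y * x) * D 1 + D 1 * (x * y + y * x))) :
    ∃ (a : Matrix (Fin n) (Fin n) Ω) (β : Ω), ∀ x, D x = a * x - x * a + β • x := by
  have hM2 (x : Matrix (Fin n) (Fin n) Ω) (hx : 2 * x = 0) : x = 0 := by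
    have : (2 : Ω) • x = 0 := by rw [← hx, two_mul, two_smul]
    exact (smul_eq_zero.1 this).resolve_left h2
  obtain ⟨β, hβ⟩ := Matrix.mem_range_scalar_of_commute_idempotent (D 1) (fun e he ↦ by
    have h1 := hD e e
    have h2M (x : Matrix (Fin n) (Fin n) Ω) : (2 : Ω) • x = 2 * x := by rw [two_smul, two_mul]
    rw [he, map_add, h2M, h2M] at h1
    exact commute_of_twisted_jordan hM2 he h1)
  rw [hβ] at hD
  let E : Matrix (Fin n) (Fin n) Ω →ₗ[Ω] Matrix (Fin n) (Fin n) Ω := D - β • LinearMap.id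
  have hE1 : E 1 = 0 := by simp [E, hβ]
  have hEj (x y) : E (x * y + y * x) = E x * y + x * E y + E y * x + y * E x := by
    have h := hD x y
    simp only [E, LinearMap.sub_apply, LinearMap.smul_apply, LinearMap.id_apply]
    rw [← sub_eq_zero] at h ⊢
    refine (smul_eq_zero.1 ?_).resolve_left h2
    rw [← h]
    simp only [mul_sub, sub_mul, smul_mul_assoc, mul_smul_comm, smul_add, smul_sub, mul_one,
      one_mul]
    module
  have hEd := map_mul_of_jordan hM2 Matrix.mul_mul_eq_zero E.toAddMonoidHom hEj (fun x hx y ↦ by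
    obtain ⟨c, rfl⟩ := Matrix.mem_range_scalar_of_commute_idempotent x fun e _ ↦ (hx e).symm
    simp [hE1])
  obtain ⟨a, ha⟩ := Matrix.exists_eq_commutator_of_leibniz E hEd
  exact ⟨a, β, fun x ↦ by rw [← ha]; simp [E]⟩

theorem Matrix.trace_pow_three {Ω n : Type*} [Field Ω] (h3 : (3 : Ω) = 0) [Fintype n]
    [DecidableEq n] (x : Matrix n n Ω) : (x * x * x).trace = x.trace ^ 3 := by
  induction x using Matrix.induction_on' with
  | h_zero => simp
  | h_add p q hp hq =>
    have e1 := Matrix.trace_mul_comm p (p * q)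
    have e2 := Matrix.trace_mul_comm (p * q) p
    have e : ((p + q) * (p + q) * (p + q)).trace = (p * p * p).trace + (q * q * q).trace +
        3 * (p * p * q).trace + 3 * (p * q * q).trace := by
      have a1 : (p * q * p).trace = (p * p * q).trace := by
        rw [Matrix.trace_mul_comm (p * q), mul_assoc]
      have a2 : (q * p * p).trace = (p * p * q).trace := by
        rw [mul_assoc, Matrix.trace_mul_comm]
      have a3 : (q * p * q).trace = (p * q * q).trace := by
        rw [mul_assoc, Matrix.trace_mul_comm]
      have a4 : (q * q * p).trace = (p * q * q).trace := by
        rw [Matrix.trace_mul_comm, mul_assoc]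
      simp only [add_mul, mul_add, Matrix.trace_add, a1, a2, a3, a4]
      ring
    rw [e, hp, hq, h3, Matrix.trace_add]
    linear_combination (-(p.trace ^ 2 * q.trace + p.trace * q.trace ^ 2)) * h3
  | h_std_basis i j c =>
    by_cases h : i = j
    · subst h; simp [pow_three, mul_assoc]
    · simp [Matrix.single_mul_single_of_ne, h, Ne.symm h, Matrix.trace_single_eq_of_ne]

/-- The identities satisfied by an additive map `D` with `x * D x * x` a sum of commutators, stated
for an additive map `τ` with the trace property. -/
theorem trace_identities {R Ω : Type*} [Ring R] [Field Ω] (h2 : (2 : Ω) ≠ 0) (τ : R →+ Ω)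
    (hτ : ∀ x y, τ (x * y) = τ (y * x)) (D : R →+ R) (hD : ∀ x, τ (x * D x * x) = 0) :
    (∀ x y, 2 * τ (x * D y) + 2 * τ (y * D x) + τ ((x * y + y * x) * D 1) = 0) ∧
    (∀ x y, τ (y * D x * y) + τ (x * D y * y) + τ (y * D y * x) = 0) := by
  have h3 (x y) : τ (y * D x * y) + τ (x * D y * y) + τ (y * D y * x) = 0 := by
    have e1 := hD (x + y)
    have e2 := hD (x - y)
    have e3 := hD x
    simp only [map_add, map_sub, mul_add, add_mul, mul_sub, sub_mul] at e1 e2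
    refine (mul_eq_zero.1 ?_).resolve_left h2
    linear_combination e1 + e2 - 2 * e3
  refine ⟨fun x y ↦ ?_, h3⟩
  have hD1 := hD 1
  have hD1x (x) := h3 x 1
  have hx1 (x) := h3 1 x
  simp only [one_mul, mul_one] at hD1 hD1x hx1
  have e1 := hx1 (x + y)
  have e2 := hx1 x
  have e3 := hx1 y
  simp only [map_add, mul_add, add_mul] at e1
  have t1 := hτ (D x) y
  have t2 := hτ (D y) x
  have t3 : τ (x * D 1 * y) = τ (y * x * D 1) := by rw [hτ, mul_assoc]
  have t4 : τ (y * D 1 * x) = τ (x * y * D 1) := by rw [hτ, mul_assoc]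
  rw [add_mul, map_add]
  linear_combination e1 - e2 - e3 - t1 - t2 - t3 - t4

open TensorProduct in
/-- A linear map on a central simple algebra that becomes inner after a field extension is inner. -/
theorem exists_eq_commutator_of_baseChange {K L B : Type*} [Field K] [Field L] [Algebra K L]
    [Ring B] [Algebra K B] (D : B → B) (s : L ⊗[K] B)
    (h : ∀ x, (1 : L) ⊗ₜ[K] D x = s * (1 ⊗ₜ x) - (1 ⊗ₜ x) * s) :
    ∃ a, ∀ x, D x = a * x - x * a := by
  obtain ⟨π, hπ⟩ := (Algebra.linearMap K L).exists_leftInverse_of_injective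
    (LinearMap.ker_eq_bot.2 (algebraMap K L).injective)
  have hπ1 : π 1 = 1 := by simpa using LinearMap.congr_fun hπ 1
  let P : L ⊗[K] B →ₗ[K] B := (TensorProduct.lid K B).toLinearMap ∘ₗ π.rTensor B
  have hP (l : L) (x : B) : P (l ⊗ₜ x) = π l • x := by simp [P]
  have hr (t : L ⊗[K] B) (x : B) : P (t * (1 ⊗ₜ x)) = P t * x := by
    induction t with
    | zero => simp
    | tmul l y => simp [hP]
    | add a b ha hb => simp [add_mul, ha, hb]
  have hl (t : L ⊗[K] B) (x : B) : P ((1 ⊗ₜ x) * t) = x * P t := by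
    induction t with
    | zero => simp
    | tmul l y => simp [hP]
    | add a b ha hb => simp [mul_add, ha, hb]
  refine ⟨P s, fun x ↦ ?_⟩
  have := congrArg P (h x)
  rwa [hP, hπ1, one_smul, map_sub, hr, hl] at this

open TensorProduct in
theorem matrix_induction_of_algEquiv {K L B : Type*} {n : ℕ} [Field K] [Field L] [Algebra K L]
    [Ring B] [Algebra K B] (e : L ⊗[K] B ≃ₐ[L] Matrix (Fin n) (Fin n) L)
    {p : Matrix (Fin n) (Fin n) L → Prop} (h0 : p 0) (hadd : ∀ X Y, p X → p Y → p (X + Y))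
    (hs : ∀ (w : L) (x : B), p (w • e (1 ⊗ₜ x))) (X) : p X := by
  obtain ⟨t, rfl⟩ := e.surjective X
  induction t with
  | zero => simpa using h0
  | tmul w x =>
    rw [← mul_one w, ← smul_eq_mul, ← TensorProduct.smul_tmul', map_smul]
    exact hs w x
  | add a b ha hb => rw [map_add]; exact hadd _ _ ha hb

open TensorProduct in
theorem eq_zero_of_trace_mul_eq_zero {K L B : Type*} {n : ℕ} [Field K] [Field L] [Algebra K L]
    [Ring B] [Algebra K B] (e : L ⊗[K] B ≃ₐ[L] Matrix (Fin n) (Fin n) L) (c : B)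
    (hc : ∀ y : B, (e (1 ⊗ₜ (y * c))).trace = 0) : c = 0 := by
  have : e (1 ⊗ₜ c) = 0 := by
    refine Matrix.ext_iff_trace_mul_left.2 fun X ↦ ?_
    rw [mul_zero, Matrix.trace_zero]
    induction X using matrix_induction_of_algEquiv e with
    | h0 => simp
    | hadd X Y hX hY => rw [add_mul, Matrix.trace_add, hX, hY, add_zero]
    | hs w x =>
      rw [smul_mul_assoc, Matrix.trace_smul, ← map_mul, Algebra.TensorProduct.tmul_mul_tmul,
        one_mul, hc, smul_zero]
  rw [map_eq_zero_iff e e.injective] at this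
  exact (map_eq_zero_iff Algebra.TensorProduct.includeRight
    (Algebra.TensorProduct.includeRight_injective (algebraMap K L).injective)).1 this

open TensorProduct in
/-- In a central simple algebra, only `0` multiplies everything into the additive span of the
commutators. -/
theorem eq_zero_of_forall_mul_mem_of_isCentral {K B : Type*} [Field K] [Ring B] [Algebra K B]
    [Algebra.IsCentral K B] [IsSimpleRing B] [FiniteDimensional K B] (c : B)
    (hc : ∀ y, y * c ∈ AddSubgroup.closure {z : B | ∃ u v : B, z = u * v - v * u}) : c = 0 := by
  have : IsSimpleRing (AlgebraicClosure K ⊗[K] B) := isSimpleRing_tensorProduct K _ B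
  obtain ⟨n, _, ⟨e⟩⟩ := IsSimpleRing.exists_algEquiv_matrix_of_isAlgClosed (AlgebraicClosure K)
    (AlgebraicClosure K ⊗[K] B)
  refine eq_zero_of_trace_mul_eq_zero e c fun y ↦ ?_
  have hy := hc y
  generalize y * c = z at hy
  induction hy using AddSubgroup.closure_induction with
  | mem x hx =>
    obtain ⟨u, v, rfl⟩ := hx
    have (u v : B) : (1 : AlgebraicClosure K) ⊗ₜ[K] (u * v) = (1 ⊗ₜ u) * (1 ⊗ₜ v) := by simp
    rw [TensorProduct.tmul_sub, this, this, map_sub, map_mul, map_mul, Matrix.trace_sub,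
      Matrix.trace_mul_comm, sub_self]
  | zero => simp
  | add x y _ _ hx hy => rw [TensorProduct.tmul_add, map_add, Matrix.trace_add, hx, hy, add_zero]
  | neg x _ hx => rw [TensorProduct.tmul_neg, map_neg, Matrix.trace_neg, hx, neg_zero]

open TensorProduct in
theorem exists_eq_commutator_of_isCentral {K B : Type*} [Field K] [Ring B] [Algebra K B]
    [Algebra.IsCentral K B] [IsSimpleRing B] [FiniteDimensional K B] (h2 : (2 : K) ≠ 0) (D : B →+ B)
    (hD : ∀ x, x * D x * x ∈ AddSubgroup.closure {z : B | ∃ u v : B, z = u * v - v * u}) :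
    ∃ a, ∀ x, D x = a * x - x * a := by
  let Ω := AlgebraicClosure K
  have : IsSimpleRing (Ω ⊗[K] B) := isSimpleRing_tensorProduct K Ω B
  obtain ⟨n, _, ⟨e⟩⟩ := IsSimpleRing.exists_algEquiv_matrix_of_isAlgClosed Ω (Ω ⊗[K] B)
  have h2Ω : (2 : Ω) ≠ 0 := by
    have := (map_ne_zero (algebraMap K Ω)).2 h2
    rwa [map_ofNat] at this
  let Φ : B →ₐ[K] Matrix (Fin n) (Fin n) Ω :=
    (e.restrictScalars K).toAlgHom.comp Algebra.TensorProduct.includeRight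
  have hΦ (w : Ω) (x : B) : e (w ⊗ₜ x) = w • Φ x := by
    rw [← mul_one w, ← smul_eq_mul, ← TensorProduct.smul_tmul', map_smul]
    simp [Φ]
  have hind {p : Matrix (Fin n) (Fin n) Ω → Prop} (h0 : p 0) (hadd : ∀ X Y, p X → p Y → p (X + Y))
      (hs : ∀ (w : Ω) x, p (w • Φ x)) (X) : p X := matrix_induction_of_algEquiv e h0 hadd hs X
  let τ : B →+ Ω := (Matrix.traceAddMonoidHom (Fin n) Ω).comp Φ.toAddMonoidHom
  have hτΦ (x) : τ x = (Φ x).trace := rfl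
  have hτ (x y) : τ (x * y) = τ (y * x) := by simp [hτΦ, Matrix.trace_mul_comm (Φ x)]
  have hnondeg (c : B) (hc : ∀ y, τ (y * c) = 0) : c = 0 := eq_zero_of_trace_mul_eq_zero e c hc
  have hD0 (x) : τ (x * D x * x) = 0 := by
    have : AddSubgroup.closure {z : B | ∃ u v : B, z = u * v - v * u} ≤ τ.ker := by
      rw [AddSubgroup.closure_le]
      rintro _ ⟨u, v, rfl⟩
      rw [SetLike.mem_coe, AddMonoidHom.mem_ker, map_sub, hτ, sub_self]
    exact this (hD x)
  obtain ⟨hbil, htri⟩ := trace_identities h2Ω τ hτ D hD0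
  have hsq (y : B) : 2 * D (y * y) = 2 * (D y * y + y * D y) - (y * y * D 1 + D 1 * (y * y)) := by
    rw [← sub_eq_zero]
    refine hnondeg _ fun x ↦ ?_
    have e1 := hbil x (y * y)
    have e2 := htri x y
    have t1 : τ (y * D x * y) = τ (y * y * D x) := by rw [hτ, ← mul_assoc]
    have t2 : τ (y * D y * x) = τ (x * (y * D y)) := hτ _ _
    have t3 : τ (y * y * x * D 1) = τ (x * (D 1 * (y * y))) := by
      rw [mul_assoc, hτ, mul_assoc]
    rw [add_mul, map_add, t3] at e1
    simp only [mul_sub, mul_add, map_sub, map_add, two_mul, mul_assoc] at e1 e2 t1 t2 ⊢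
    linear_combination e1 - 2 * e2 + 2 * t1 + 2 * t2
  have hjor (x y : B) : 2 * D (x * y + y * x) = 2 * (D x * y + x * D y + D y * x + y * D x) -
      ((x * y + y * x) * D 1 + D 1 * (x * y + y * x)) := by
    have e : x * y + y * x = (x + y) * (x + y) - x * x - y * y := by noncomm_ring
    rw [e, map_sub, map_sub, mul_sub, mul_sub, hsq, hsq, hsq, map_add]
    noncomm_ring
  have hτD (x) : τ (D x) = -2 * τ (x * D 1) := by
    have e1 := hbil 1 x
    simp only [one_mul, mul_one, add_mul, map_add] at e1
    refine mul_left_cancel₀ h2Ω ?_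
    linear_combination e1
  have hB2 (x : B) (hx : 2 * x = 0) : x = 0 := by
    have : (2 : K) • x = 0 := by rw [← hx, two_mul, two_smul]
    exact (smul_eq_zero.1 this).resolve_left h2
  have hτsmul (k : K) (x) : τ (k • x) = algebraMap K Ω k * τ x := by
    rw [hτΦ, map_smul, Matrix.trace_smul, hτΦ, Algebra.smul_def]
  have hlin (k : K) (y : B) : D (k • y) = k • D y := by
    have e1 (y : B) : 4 * (D (k • y) - k • D y) =
        2 * (y * (D (algebraMap K B k) - k • D 1) + (D (algebraMap K B k) - k • D 1) * y) := by
      have e2 := hjor (algebraMap K B k) y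
      rw [← Algebra.commutes k y, ← two_mul, ← Algebra.commutes k (D y), ← Algebra.smul_def,
        ← Algebra.smul_def, show D (2 * (k • y)) = D (k • y) + D (k • y) by rw [two_mul, map_add]] at e2
      have e3 : 2 * (D (k • y) + D (k • y)) = 4 * D (k • y) := by noncomm_ring
      rw [mul_sub, ← e3, e2]
      simp only [mul_sub, sub_mul, mul_smul_comm, smul_mul_assoc, mul_add, add_mul, two_mul]
      have e4 : 4 * D y = D y + D y + D y + D y := by noncomm_ring
      rw [e4]
      module
    have hw : D (algebraMap K B k) - k • D 1 = 0 := by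
      refine hnondeg _ fun y ↦ ?_
      have e2 := congrArg τ (e1 y)
      have four (z : B) : τ (4 * z) = 4 * τ z := by
        rw [show 4 * z = z + z + z + z by noncomm_ring]
        simp only [map_add]; ring
      rw [four, map_sub, hτD, hτsmul, hτD, smul_mul_assoc, hτsmul, two_mul, map_add, map_add,
        hτ _ y] at e2
      refine (mul_eq_zero.1 ?_).resolve_left (mul_ne_zero h2Ω h2Ω)
      linear_combination -e2
    have e2 := e1 y
    rw [hw, mul_zero, zero_mul, add_zero, mul_zero] at e2
    refine sub_eq_zero.1 (hB2 _ (hB2 _ ?_))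
    rw [← e2]
    noncomm_ring
  let D' : B →ₗ[K] B := { D with map_smul' := hlin }
  let DΩ : Matrix (Fin n) (Fin n) Ω →ₗ[Ω] Matrix (Fin n) (Fin n) Ω :=
    e.toLinearMap ∘ₗ D'.baseChange Ω ∘ₗ e.symm.toLinearMap
  have hDΩ (x : B) : DΩ (Φ x) = Φ (D x) := by
    have : Φ x = e (1 ⊗ₜ x) := by simp [hΦ]
    change e (D'.baseChange Ω (e.symm (Φ x))) = _
    rw [this, e.symm_apply_apply, LinearMap.baseChange_tmul, hΦ, one_smul]
    rfl
  have hDΩ1 : DΩ 1 = Φ (D 1) := by rw [← hDΩ, map_one Φ]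
  obtain ⟨a, β, haβ⟩ := Matrix.exists_eq_commutator_add_smul h2Ω DΩ (by
    intro X Y
    induction X using hind with
    | h0 => simp
    | hadd X X' hX hX' =>
      have e : (X + X') * Y + Y * (X + X') = (X * Y + Y * X) + (X' * Y + Y * X') := by noncomm_ring
      rw [e, map_add, smul_add, hX, hX', map_add]
      simp only [add_mul, mul_add, smul_add]
      abel
    | hs w x =>
      induction Y using hind with
      | h0 => simp
      | hadd Y Y' hY hY' =>
        have e (X : Matrix (Fin n) (Fin n) Ω) :
          X * (Y + Y') + (Y + Y') * X = (X * Y + Y * X) + (X * Y' + Y' * X) := by noncomm_ring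
        rw [e, map_add, smul_add, hY, hY', map_add]
        simp only [add_mul, mul_add, smul_add]
        abel
      | hs v y =>
        have e := congrArg Φ (hjor x y)
        simp only [two_mul, map_add, map_sub, map_mul, ← hDΩ1, ← hDΩ] at e
        simp only [map_smul, smul_mul_assoc, mul_smul_comm, map_add, two_smul]
        simp only [smul_comm v w, ← smul_add, e]
        simp only [smul_sub, smul_add, mul_add, add_mul, smul_mul_assoc, mul_smul_comm])
  have h3β : 3 * β = 0 := by
    have htr (X) : (DΩ X).trace = -2 * (X * DΩ 1).trace := by
      induction X using hind with
      | h0 => simp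
      | hadd X Y hX hY =>
        rw [map_add, Matrix.trace_add, hX, hY, add_mul, Matrix.trace_add, mul_add]
      | hs w x =>
        rw [map_smul, Matrix.trace_smul, hDΩ, hDΩ1, smul_mul_assoc, Matrix.trace_smul, ← map_mul,
          ← hτΦ, ← hτΦ, hτD, smul_eq_mul, smul_eq_mul]
        ring
    have := htr (Matrix.single 0 0 1)
    rw [haβ, haβ 1, Matrix.trace_add, Matrix.trace_sub, Matrix.trace_mul_comm a, sub_self] at this
    simp at this
    linear_combination this
  have hβ : β = 0 := by
    refine (mul_eq_zero.1 h3β).elim (fun h3 ↦ ?_) id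
    by_contra hβ0
    refine one_ne_zero (hnondeg 1 fun x ↦ ?_)
    have e0 : (Φ x * (a * Φ x - Φ x * a) * Φ x).trace = 0 := by
      have := Matrix.trace_mul_comm (Φ x) (Φ x * a * Φ x)
      simp only [mul_sub, sub_mul, Matrix.trace_sub, mul_assoc] at this ⊢
      rw [this, sub_self]
    have e1 := hD0 x
    rw [hτΦ, map_mul, map_mul, ← hDΩ, haβ, mul_add, add_mul, Matrix.trace_add, e0, mul_smul_comm,
      smul_mul_assoc, Matrix.trace_smul, Matrix.trace_pow_three h3, zero_add] at e1
    rw [mul_one, hτΦ]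
    exact pow_eq_zero_iff (three_ne_zero) |>.1 ((smul_eq_zero.1 e1).resolve_left hβ0)
  refine exists_eq_commutator_of_baseChange (K := K) (L := Ω) D (e.symm a) fun x ↦ e.injective ?_
  have := haβ (Φ x)
  rw [hβ, zero_smul, add_zero, hDΩ] at this
  simpa [hΦ] using this

theorem exists_isCentral_field.{u} (F : Type*) (B : Type u) [Field F] [Ring B] [Algebra F B] [IsSimpleRing B]
    [FiniteDimensional F B] : ∃ (K : Type u) (_ : Field K) (_ : Algebra K B),
      Algebra.IsCentral K B ∧ FiniteDimensional K B := by
  have hfin : Module.Finite (Subring.center B) B := by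
    obtain ⟨s, hs⟩ := Module.Finite.fg_top (R := F) (M := B)
    refine ⟨s, eq_top_iff.2 fun x _ ↦ ?_⟩
    have hx : x ∈ Submodule.span F (s : Set B) := hs ▸ trivial
    induction hx using Submodule.span_induction with
    | mem x hx => exact Submodule.subset_span hx
    | zero => exact zero_mem _
    | add x y _ _ hx hy => exact add_mem (hx trivial) (hy trivial)
    | smul k x _ hx =>
      have hk : algebraMap F B k ∈ Subring.center B :=
        Subring.mem_center_iff.2 fun y ↦ (Algebra.commutes k y).symm
      rw [Algebra.smul_def]
      exact Submodule.smul_mem _ (⟨_, hk⟩ : Subring.center B) (hx trivial)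
  have hbot (x : B) (hx : x ∈ Subring.center B) : x ∈ (⊥ : Subalgebra (Subring.center B) B) :=
    Algebra.mem_bot.2 ⟨⟨x, hx⟩, rfl⟩
  have hcen : Algebra.IsCentral (Subring.center B) B :=
    ⟨fun x hx ↦ hbot x (Subring.mem_center_iff.2 (Subalgebra.mem_center_iff.1 hx))⟩
  let a : Algebra (Subring.center B) B := inferInstance
  exact ⟨Subring.center B, (IsSimpleRing.isField_center B).toField, a, hcen, hfin⟩

theorem exists_eq_commutator_of_isSimpleRing (F : Type*) {B : Type*} [Field F] [Ring B]
    [Algebra F B] [IsSimpleRing B] [FiniteDimensional F B] (h2 : (2 : F) ≠ 0) (D : B →+ B)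
    (hD : ∀ x, x * D x * x ∈ AddSubgroup.closure {z : B | ∃ u v : B, z = u * v - v * u}) :
    ∃ a, ∀ x, D x = a * x - x * a := by
  obtain ⟨K, _, _, _, _⟩ := exists_isCentral_field F B
  refine exists_eq_commutator_of_isCentral (K := K) (fun h ↦ h2 ?_) D hD
  have h := congrArg (algebraMap K B) h
  rw [map_ofNat, map_zero, ← map_ofNat (algebraMap F B)] at h
  exact (map_eq_zero_iff _ (algebraMap F B).injective).1 h

theorem eq_zero_of_forall_mul_mem (F : Type*) {B : Type*} [Field F] [Ring B] [Algebra F B]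
    [IsSimpleRing B] [FiniteDimensional F B] (c : B)
    (hc : ∀ y, y * c ∈ AddSubgroup.closure {z : B | ∃ u v : B, z = u * v - v * u}) : c = 0 := by
  obtain ⟨K, _, _, _, _⟩ := exists_isCentral_field F B
  exact eq_zero_of_forall_mul_mem_of_isCentral (K := K) c hc

theorem TwoSidedIdeal.isSimpleRing_quotient {A : Type*} [Ring A] {M : TwoSidedIdeal A}
    (hM : IsCoatom M) : IsSimpleRing M.ringCon.Quotient := by
  have hmem (x : A) : M.ringCon.mk' x = 0 ↔ x ∈ M := by
    rw [← TwoSidedIdeal.mem_ker, TwoSidedIdeal.ker_ringCon_mk']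
  have hsurj := M.ringCon.mk'_surjective
  have : Nontrivial (TwoSidedIdeal M.ringCon.Quotient) := by
    refine ⟨⊥, ⊤, fun h ↦ hM.1 (eq_top_iff.2 fun x _ ↦ (hmem x).1 ?_)⟩
    rw [← TwoSidedIdeal.mem_bot, h]
    trivial
  refine ⟨⟨fun J ↦ ?_⟩⟩
  have hle : M ≤ TwoSidedIdeal.comap M.ringCon.mk' J := fun x hx ↦ by
    rw [TwoSidedIdeal.mem_comap, (hmem x).2 hx]
    exact J.zero_mem
  obtain h | h := hM.le_iff.1 hle
  · refine .inr (eq_top_iff.2 fun y _ ↦ ?_)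
    obtain ⟨x, rfl⟩ := hsurj y
    have : x ∈ TwoSidedIdeal.comap M.ringCon.mk' J := h ▸ trivial
    exact TwoSidedIdeal.mem_comap _ |>.1 this
  · refine .inl (eq_bot_iff.2 fun y hy ↦ ?_)
    obtain ⟨x, rfl⟩ := hsurj y
    have : x ∈ M := h ▸ (TwoSidedIdeal.mem_comap _).2 hy
    exact (TwoSidedIdeal.mem_bot _).2 ((hmem x).2 this)

/-- Linearization of `x * D x * x ∈ [A, A]`. -/
theorem two_mul_add_mem_of_mul_mul_mem {F A : Type*} [Field F] [Ring A] [Algebra F A]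
    (h2 : (2 : F) ≠ 0) (C : Submodule F A) (hC : ∀ x y, x * y - y * x ∈ C) (D : A →ₗ[F] A)
    (hD : ∀ x, x * D x * x ∈ C) (x y : A) :
    2 * (x * D y + y * D x) + (x * y + y * x) * D 1 ∈ C := by
  have half (z : A) (hz : z + z ∈ C) : z ∈ C := by
    rw [← two_smul F] at hz
    exact (C.smul_mem_iff h2).1 hz
  have h (x : A) : x * D x + D x * x + x * D 1 * x ∈ C := by
    have e := C.sub_mem (C.sub_mem (hD (x + 1)) (hD (x - 1))) (C.add_mem (hD 1) (hD 1))
    refine half _ ?_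
    convert e using 1
    rw [map_add, map_sub]
    noncomm_ring
  have e := C.sub_mem (C.sub_mem (h (x + y)) (h x)) (h y)
  convert C.add_mem e (C.add_mem (C.add_mem (hC x (D y)) (hC y (D x)))
    (C.add_mem (hC x (y * D 1)) (hC y (x * D 1)))) using 1
  rw [map_add]
  noncomm_ring

open TwoSidedIdeal in
theorem exists_sub_commutator_mem_of_isCoatom {F A : Type*} [Field F] [Ring A] [Algebra F A]
    [FiniteDimensional F A] (h2 : (2 : F) ≠ 0) (D : A →ₗ[F] A)
    (hD : ∀ x : A, x * D x * x ∈ Submodule.span F {z : A | ∃ u v : A, z = u * v - v * u})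
    {M : TwoSidedIdeal A} (hM : IsCoatom M) : ∃ a, ∀ x, D x - (a * x - x * a) ∈ M := by
  have : IsSimpleRing M.ringCon.Quotient := isSimpleRing_quotient hM
  let π : A →+* M.ringCon.Quotient := M.ringCon.mk'
  have hmem (x : A) : π x = 0 ↔ x ∈ M := by
    rw [← TwoSidedIdeal.mem_ker, TwoSidedIdeal.ker_ringCon_mk']
  have hsurj : Function.Surjective π := M.ringCon.mk'_surjective
  let πF : A →ₗ[F] M.ringCon.Quotient := { π with map_smul' := fun _ _ ↦ rfl }
  have : FiniteDimensional F M.ringCon.Quotient := Module.Finite.of_surjective πF hsurj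
  set C := AddSubgroup.closure {z : M.ringCon.Quotient | ∃ u v, z = u * v - v * u} with hC
  have hπC {x : A} (hx : x ∈ Submodule.span F {z : A | ∃ u v : A, z = u * v - v * u}) :
      π x ∈ C := by
    induction hx using Submodule.span_induction with
    | mem x hx =>
      obtain ⟨u, v, rfl⟩ := hx
      exact AddSubgroup.subset_closure ⟨π u, π v, by simp⟩
    | zero => rw [map_zero]; exact C.zero_mem
    | add x y _ _ hx hy => rw [map_add]; exact C.add_mem hx hy
    | smul k x _ hx =>
      change k • π x ∈ C
      generalize π x = z at hx
      induction hx using AddSubgroup.closure_induction with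
      | mem x hx =>
        obtain ⟨u, v, rfl⟩ := hx
        exact AddSubgroup.subset_closure ⟨k • u, v, by simp [smul_sub]⟩
      | zero => rw [smul_zero]; exact C.zero_mem
      | add x y _ _ hx hy => rw [smul_add]; exact C.add_mem hx hy
      | neg x _ hx => rw [smul_neg]; exact C.neg_mem hx
  have hDM (x : A) (hx : x ∈ M) : π (D x) = 0 := by
    rw [← hmem] at hx
    refine eq_zero_of_forall_mul_mem F _ fun z ↦ ?_
    obtain ⟨y, hy⟩ := hsurj ((2 : F)⁻¹ • z)
    have hz : 2 * π y = z := by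
      rw [hy, two_mul, ← two_smul F, smul_smul, mul_inv_cancel₀ h2, one_smul]
    have := hπC (two_mul_add_mem_of_mul_mul_mem h2
      (Submodule.span F {z : A | ∃ u v : A, z = u * v - v * u})
      (fun u v ↦ Submodule.subset_span ⟨u, v, rfl⟩) D hD x y)
    simpa only [map_add, map_mul, map_ofNat, hx, zero_mul, mul_zero, zero_add, add_zero,
      ← mul_assoc, hz] using this
  let g : A →+ M.ringCon.Quotient := (π : A →+ M.ringCon.Quotient).comp D.toAddMonoidHom
  obtain ⟨D', hD'⟩ : ∃ D' : M.ringCon.Quotient →+ M.ringCon.Quotient, ∀ x, D' (π x) = π (D x) :=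
    ⟨(π : A →+ M.ringCon.Quotient).liftOfRightInverse _ (Function.rightInverse_surjInv hsurj)
      ⟨g, fun x hx ↦ hDM x ((hmem x).1 hx)⟩,
      fun x ↦ AddMonoidHom.liftOfRightInverse_comp_apply (π : A →+ M.ringCon.Quotient) _ _ _ x⟩
  obtain ⟨b, hb⟩ := exists_eq_commutator_of_isSimpleRing F h2 D' fun z ↦ by
    obtain ⟨x, rfl⟩ := hsurj z
    rw [hD', ← map_mul, ← map_mul]
    exact hπC (hD x)
  obtain ⟨a, rfl⟩ := hsurj b
  refine ⟨a, fun x ↦ (hmem _).1 ?_⟩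
  rw [map_sub, ← hD', hb, map_sub, map_mul, map_mul, sub_self]

theorem TwoSidedIdeal.exists_sub_commutator_mem_inf {A : Type*} [Ring A] {D : A → A}
    {I M : TwoSidedIdeal A} (hM : IsCoatom M) (hI : ∃ a, ∀ x, D x - (a * x - x * a) ∈ I)
    (hDM : ∃ a, ∀ x, D x - (a * x - x * a) ∈ M) : ∃ a, ∀ x, D x - (a * x - x * a) ∈ I ⊓ M := by
  by_cases hle : I ≤ M
  · rwa [inf_eq_left.2 hle]
  have htop : I ⊔ M = ⊤ := (hM.le_iff.1 le_sup_right).resolve_right fun h ↦ hle (h ▸ le_sup_left)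
  obtain ⟨u, hu, v, hv, huv⟩ := TwoSidedIdeal.mem_sup.1 (htop ▸ trivial : (1 : A) ∈ I ⊔ M)
  obtain ⟨a, ha⟩ := hI
  obtain ⟨b, hb⟩ := hDM
  have key (J : TwoSidedIdeal A) (a b u v : A) (huv : u + v = 1) (hu : u ∈ J)
      (ha : ∀ x, D x - (a * x - x * a) ∈ J) (x : A) :
      D x - ((a * v + b * u) * x - x * (a * v + b * u)) ∈ J := by
    have e : D x - ((a * v + b * u) * x - x * (a * v + b * u)) =
        D x - (a * x - x * a) + ((a - b) * u * x - x * ((a - b) * u)) := by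
      rw [← sub_eq_iff_eq_add'.2 huv.symm]
      noncomm_ring
    have hu' : (a - b) * u ∈ J := J.mul_mem_left _ _ hu
    rw [e]
    exact J.add_mem (ha x) (J.sub_mem (J.mul_mem_right _ _ hu') (J.mul_mem_left _ _ hu'))
  refine ⟨a * v + b * u, fun x ↦ (TwoSidedIdeal.mem_inf _).2 ⟨key I a b u v huv hu ha x, ?_⟩⟩
  rw [add_comm (a * v)]
  exact key M b a v u (by rw [add_comm, huv]) hv hb x

/-- **Theorem 2.4.** Let `A` be a finite-dimensional algebra over a field `F` with
`char F ≠ 2`. If a linear map `D : A → A` satisfies `x * D x * x ∈ [A,A]` for every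
`x ∈ A`, then `D` is the sum of an inner derivation and a linear map with image in
`rad A`. -/
theorem sum_inner_derivation_radical_map (F A : Type*) [Field F] [Ring A] [Algebra F A]
    [FiniteDimensional F A] (h2 : (2 : F) ≠ 0) (D : A →ₗ[F] A)
    (hD : ∀ x : A, x * D x * x ∈ Submodule.span F {z : A | ∃ u v : A, z = u * v - v * u}) :
    ∃ (a : A) (N : A →ₗ[F] A), (∀ x : A, N x ∈ ringRad A) ∧
      ∀ x : A, D x = a * x - x * a + N x := by
  have : IsArtinianRing A := IsArtinianRing.of_finite F A
  have hmono : StrictMono (TwoSidedIdeal.asIdeal (R := A)) :=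
    TwoSidedIdeal.asIdeal.monotone.strictMono_of_injective fun I J h ↦
      TwoSidedIdeal.ext fun x ↦ by rw [← TwoSidedIdeal.mem_asIdeal, h, TwoSidedIdeal.mem_asIdeal]
  have hwf : WellFoundedLT (TwoSidedIdeal A) := hmono.wellFoundedLT
  obtain ⟨I, hI, hmin⟩ := hwf.wf.has_min
    {I : TwoSidedIdeal A | ∃ a, ∀ x, D x - (a * x - x * a) ∈ I} ⟨⊤, 0, fun _ ↦ trivial⟩
  have hle : I ≤ ringRad A := le_sInf fun M hM ↦ by
    have hIM := TwoSidedIdeal.exists_sub_commutator_mem_inf hM hI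
      (exists_sub_commutator_mem_of_isCoatom h2 D hD hM)
    exact inf_eq_left.1 (inf_le_left.eq_or_lt.resolve_right (hmin _ hIM))
  obtain ⟨a, ha⟩ := hI
  refine ⟨a, D - (LinearMap.mulLeft F a - LinearMap.mulRight F a), fun x ↦ hle (ha x), fun x ↦ ?_⟩
  simp
end

section
/- Let A be a finite-dimensional semisimple algebra over a field F with char(F) ≠ 2. For a linear map D : A → A the following conditions are equivalent: (i) xD(x)x ∈ [A,A] for every x ∈ A; (ii) D is an inner derivation of A, i.e., there exists a ∈ A such that D(x) = ax − xa for all x ∈ A. -/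
open scoped TensorProduct

theorem IsSemisimpleRing.exists_mul_mul_eq {A : Type*} [Ring A] [IsSemisimpleRing A] (a : A) :
    ∃ r, a * r * a = a := by
  obtain ⟨e, he, hI⟩ := IsSemisimpleRing.ideal_eq_span_idempotent (Ideal.span {a})
  obtain ⟨r, hr⟩ := Ideal.mem_span_singleton'.1 (hI ▸ Ideal.mem_span_singleton_self e : e ∈ _)
  obtain ⟨s, hs⟩ := Ideal.mem_span_singleton'.1 (hI ▸ Ideal.mem_span_singleton_self a : a ∈ _)
  refine ⟨r, ?_⟩
  rw [mul_assoc, hr, ← hs, mul_assoc, he.eq]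

theorem IsSemisimpleRing.eq_zero_of_mul_mul_self {A : Type*} [Ring A] [IsSemisimpleRing A] (a : A)
    (h : ∀ x, a * x * a = 0) : a = 0 := by
  obtain ⟨r, hr⟩ := IsSemisimpleRing.exists_mul_mul_eq a
  rw [← hr, h]

theorem eq_zero_of_isIdempotentElem_of_mem_jacobson {B : Type*} [Ring B] {e : B}
    (he : IsIdempotentElem e) (h : e ∈ Ring.jacobson B) : e = 0 := by
  rw [← Ideal.jacobson_bot] at h
  obtain ⟨z, hz⟩ := Ideal.mem_jacobson_iff.1 h (-1)
  have hz' : z * (1 - e) = 1 := by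
    rw [Ideal.mem_bot] at hz
    linear_combination (norm := noncomm_ring) hz
  calc e = z * (1 - e) * e := by rw [hz', one_mul]
    _ = z * (e - e * e) := by noncomm_ring
    _ = 0 := by rw [he.eq, sub_self, mul_zero]

theorem exists_algHom_matrix_map_ne_zero {F A : Type*} (K : Type*) [Field F] [Field K]
    [IsAlgClosed K] [Algebra F K] [Ring A] [Algebra F A] [FiniteDimensional F A]
    [IsSemisimpleRing A] {a : A} (ha : a ≠ 0) :
    ∃ (n : ℕ) (π : K ⊗[F] A →ₐ[K] Matrix (Fin n) (Fin n) K), Function.Surjective π ∧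
      π (1 ⊗ₜ a) ≠ 0 := by
  obtain ⟨r, hr⟩ := IsSemisimpleRing.exists_mul_mul_eq a
  have : IsArtinianRing (K ⊗[F] A) := IsArtinianRing.of_finite K _
  let J := Ring.jacobson (K ⊗[F] A)
  have hss : IsSemisimpleRing ((K ⊗[F] A) ⧸ J) := IsSemiprimaryRing.isSemisimpleRing
  obtain ⟨n, d, -, ⟨e⟩⟩ :=
    IsSemisimpleRing.exists_algEquiv_pi_matrix_of_isAlgClosed K ((K ⊗[F] A) ⧸ J)
  have hJ : Ideal.Quotient.mkₐ K J (1 ⊗ₜ a) ≠ 0 := by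
    intro h
    have hm : (1 : K) ⊗ₜ[F] a ∈ J := Ideal.Quotient.eq_zero_iff_mem.1 h
    have hid : IsIdempotentElem ((1 : K) ⊗ₜ[F] (r * a)) := by
      simp only [IsIdempotentElem, Algebra.TensorProduct.tmul_mul_tmul, mul_one]
      rw [mul_assoc, ← mul_assoc a, hr]
    have h0 := eq_zero_of_isIdempotentElem_of_mem_jacobson hid
      (by simpa using J.mul_mem_left ((1 : K) ⊗ₜ[F] r) hm)
    have : r * a = 0 := Algebra.TensorProduct.includeRight_injective (R := F) (A := K) (B := A)
      (algebraMap F K).injective (by simpa using h0)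
    exact ha (by rw [← hr, mul_assoc, this, mul_zero])
  obtain ⟨i, hi⟩ := Function.ne_iff.1 ((map_ne_zero_iff e e.injective).2 hJ)
  refine ⟨d i, ((Pi.evalAlgHom K (fun i => Matrix (Fin (d i)) (Fin (d i)) K) i).comp
    e.toAlgHom).comp (Ideal.Quotient.mkₐ K J), ?_, hi⟩
  exact ((Function.surjective_eval i).comp e.surjective).comp (Ideal.Quotient.mkₐ_surjective K J)

theorem span_range_eq_top {F A K M : Type*} [Field F] [Field K]
    [Algebra F K] [Ring A] [Algebra F A] [Ring M] [Algebra K M]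
    {π : K ⊗[F] A →ₐ[K] M} (hπ : Function.Surjective π) :
    Submodule.span K (Set.range fun a : A => π (1 ⊗ₜ a)) = ⊤ := by
  rw [eq_top_iff]
  rintro m -
  obtain ⟨b, rfl⟩ := hπ m
  induction b using TensorProduct.induction_on with
  | zero => simp
  | add x y hx hy => rw [map_add]; exact add_mem hx hy
  | tmul k a =>
    have : k ⊗ₜ[F] a = k • (1 ⊗ₜ[F] a) := by simp [TensorProduct.smul_tmul']
    rw [this, map_smul]
    exact Submodule.smul_mem _ _ (Submodule.subset_span ⟨a, rfl⟩)

theorem Matrix.commute_of_commute_idempotent {n K : Type*} [Fintype n] [DecidableEq n] [Ring K]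
    {y : Matrix n n K} (h : ∀ e, IsIdempotentElem e → Commute y e) (i j : n) :
    Commute y (single i j 1) := by
  have hi := h (single i i 1) (by simp [IsIdempotentElem])
  by_cases hij : i = j
  · exact hij ▸ hi
  · have := h (single i i 1 + single i j 1) (by
      simp [IsIdempotentElem, mul_add, add_mul, Ne.symm hij])
    simpa using this.sub_right hi

theorem ad_pow_four_apply_one {B : Type*} [Ring B] (h2 : ∀ b : B, b + b = 0 → b = 0)
    (D : B →+ B)
    (hD : ∀ x y, 2 * D (x * y + y * x) = 2 * (x * D y + D y * x + y * D x + D x * y)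
      - (D 1 * (x * y + y * x) + (x * y + y * x) * D 1)) (x : B) :
    x ^ 4 * D 1 - 4 * (x ^ 3 * D 1 * x) + 6 * (x ^ 2 * D 1 * x ^ 2) - 4 * (x * D 1 * x ^ 3)
      + D 1 * x ^ 4 = 0 := by
  generalize D 1 = d at *
  have e2 := hD x x
  have e3 := hD x (x * x)
  have e4 := hD x (x * x * x)
  have e4' := hD (x * x) (x * x)
  simp only [← mul_assoc, D.map_add] at e2 e3 e4 e4'
  generalize D (x * x * x * x) = D4 at *
  generalize D (x * x * x) = D3 at *
  generalize D (x * x) = D2 at *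
  generalize D x = s at *
  apply h2
  linear_combination (norm := noncomm_ring) -4 * e4 + 4 * e4' - 2 * x * e3 - 2 * e3 * x
    + 3 * x * x * e2 + 3 * e2 * x * x - 2 * x * e2 * x

theorem mul_mul_eq_zero_of_add_swap {R : Type*} [Ring R] (h2 : ∀ b : R, b + b = 0 → b = 0)
    (hR : ∀ a : R, (∀ x, a * x * a = 0) → a = 0) {a b : R}
    (h : ∀ x, a * x * b + b * x * a = 0) (x : R) : a * x * b = 0 := by
  refine hR _ fun y => h2 _ ?_
  linear_combination (norm := noncomm_ring)
    a * x * h y * x * b - h (x * a * y) * x * b + h x * y * a * x * b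

theorem jordan_mul_add_mul {R : Type*} [Ring R] {δ : R →+ R}
    (hδ : ∀ x, δ (x * x) = x * δ x + δ x * x) (x y : R) :
    δ (x * y) + δ (y * x) = x * δ y + δ y * x + y * δ x + δ x * y := by
  have h := hδ (x + y)
  simp only [add_mul, mul_add, map_add, hδ] at h
  linear_combination (norm := noncomm_ring) h

theorem jordan_mul_mul {R : Type*} [Ring R] (h2 : ∀ b : R, b + b = 0 → b = 0) {δ : R →+ R}
    (hδ : ∀ x, δ (x * x) = x * δ x + δ x * x) (x y : R) :
    δ (x * y * x) = δ x * y * x + x * δ y * x + x * y * δ x := by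
  have h := jordan_mul_add_mul hδ
  have e1 := h x (x * y + y * x)
  have e2 := h (x * x) y
  have e3 := h x y
  have e4 := hδ x
  simp only [mul_add, add_mul, map_add, ← mul_assoc] at e1 e2
  rw [← sub_eq_zero]
  apply h2
  linear_combination (norm := noncomm_ring) e1 - e2 + x * e3 + e3 * x - y * e4 - e4 * y

theorem jordan_mul_mul_add {R : Type*} [Ring R] (h2 : ∀ b : R, b + b = 0 → b = 0) {δ : R →+ R}
    (hδ : ∀ x, δ (x * x) = x * δ x + δ x * x) (x y z : R) :
    δ (x * y * z) + δ (z * y * x) = δ x * y * z + x * δ y * z + x * y * δ z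
      + (δ z * y * x + z * δ y * x + z * y * δ x) := by
  have h := jordan_mul_mul h2 hδ
  have e := h (x + z) y
  have e1 := h x y
  have e2 := h z y
  simp only [mul_add, add_mul, map_add] at e
  linear_combination (norm := noncomm_ring) e - e1 - e2

theorem defect_mul_commutator {R : Type*} [Ring R] (h2 : ∀ b : R, b + b = 0 → b = 0) {δ : R →+ R}
    (hδ : ∀ x, δ (x * x) = x * δ x + δ x * x) (a b x : R) :
    (δ (a * b) - δ a * b - a * δ b) * x * (a * b - b * a)
      + (a * b - b * a) * x * (δ (a * b) - δ a * b - a * δ b) = 0 := by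
  have e1 := jordan_mul_mul_add h2 hδ (a * b) x (b * a)
  have e2 := jordan_mul_mul h2 hδ a (b * x * b)
  have e3 := jordan_mul_mul h2 hδ b (a * x * a)
  have e4 := jordan_mul_mul h2 hδ b x
  have e5 := jordan_mul_mul h2 hδ a x
  have e6 := jordan_mul_add_mul hδ a b
  simp only [← mul_assoc] at e1 e2 e3
  linear_combination (norm := noncomm_ring) e1 - e2 - e3 - a * e4 * a - b * e5 * b
    + e6 * x * a * b + a * b * x * e6

theorem jordan_derivation_map_mul {R : Type*} [Ring R] (h2 : ∀ b : R, b + b = 0 → b = 0)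
    (hR : ∀ a : R, (∀ x, a * x * a = 0) → a = 0) {δ : R →+ R}
    (hδ : ∀ x, δ (x * x) = x * δ x + δ x * x) (a b : R) : δ (a * b) = δ a * b + a * δ b := by
  set h : R → R → R := fun a b => δ (a * b) - δ a * b - a * δ b with h_def
  have h_add_left (a a' b) : h (a + a') b = h a b + h a' b := by
    simp only [h_def, add_mul, map_add]; abel
  have h_add_right (a b b') : h a (b + b') = h a b + h a b' := by
    simp only [h_def, mul_add, map_add]; abel
  have k0 (a b x) : h a b * x * (a * b - b * a) = 0 :=
    mul_mul_eq_zero_of_add_swap h2 hR (defect_mul_commutator h2 hδ a b) x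
  have k0' (a b x) : (a * b - b * a) * x * h a b = 0 := by
    have := defect_mul_commutator h2 hδ a b x
    rwa [k0 a b x, zero_add] at this
  have k1 (a b c x) : h a b * x * (a * c - c * a) = 0 := by
    refine hR _ fun y => ?_
    have e := k0 a (b + c) x
    rw [h_add_right] at e
    linear_combination (norm := noncomm_ring) h a b * x * (a * c - c * a) * y * e
      - h a b * x * (a * c - c * a) * y * k0 a b x - h a b * x * (a * c - c * a) * y * k0 a c x
      - h a b * x * k0' a c y * x * (a * b - b * a)
  have k1' (a b c x) : (a * c - c * a) * x * h a b = 0 := by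
    refine hR _ fun y => ?_
    linear_combination (norm := noncomm_ring) (a * c - c * a) * x * k1 a b c y * x * h a b
  have k2 (a b c d x) : h a b * x * (d * c - c * d) = 0 := by
    refine hR _ fun y => ?_
    have e := k1 (a + d) b c x
    rw [h_add_left] at e
    linear_combination (norm := noncomm_ring) h a b * x * (d * c - c * d) * y * e
      - h a b * x * (d * c - c * d) * y * k1 a b c x - h a b * x * (d * c - c * d) * y * k1 d b c x
      - h a b * x * k1' d b c y * x * (a * c - c * a)
  have hc (y) : h a b * y - y * h a b = 0 := by
    refine hR _ fun x => ?_
    linear_combination (norm := noncomm_ring)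
      k2 a b y (h a b) (y * x) - y * k2 a b y (h a b) x
  have e0 : h a b * (a * b - b * a) = 0 := by simpa using k2 a b b a 1
  have e1 := jordan_mul_add_mul hδ (h a b) (a * b - b * a)
  have e2 := jordan_mul_add_mul hδ a b
  have e3 : (a * b - b * a) * h a b = 0 := by
    linear_combination (norm := noncomm_ring) e0 - hc (a * b - b * a)
  rw [e0, e3, map_zero, map_sub] at e1
  have e4 : h a b = δ (a * b) - δ a * b - a * δ b := rfl
  have k3 := k2 a b b (δ a) 1
  have k4 := k2 a b (δ b) a 1
  have k5 := k2 a b b a (δ (h a b))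
  generalize δ (h a b) = w at *
  generalize h a b = u at *
  have e5 : u * u * u = 0 := by
    apply h2
    apply h2
    linear_combination (norm := noncomm_ring) -u * e1 + 2 * u * u * e4 + 2 * u * e4 * u
      + u * u * e2 + u * e2 * u - u * (k3 + k4) - (k3 + k4) * u - e0 * w - k5
  have e6 : u * u = 0 := hR _ fun x => by
    linear_combination (norm := noncomm_ring) e5 * u * x - u * u * hc x * u - u * u * u * hc x
  have e7 : u = 0 := hR _ fun x => by
    linear_combination (norm := noncomm_ring) e6 * x - u * hc x
  rw [e7] at e4
  linear_combination (norm := noncomm_ring) -e4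

theorem exists_algHom_matrix {F A : Type*} (K : Type*) [Field F] [Field K] [IsAlgClosed K]
    [Algebra F K] [Ring A] [Algebra F A] [FiniteDimensional F A] [IsSemisimpleRing A]
    {a : A} (ha : a ≠ 0) :
    ∃ (n : ℕ) (φ : A →ₐ[F] Matrix (Fin n) (Fin n) K),
      Submodule.span K (Set.range φ) = ⊤ ∧ φ a ≠ 0 := by
  obtain ⟨n, π, hπ, h⟩ := exists_algHom_matrix_map_ne_zero (F := F) K ha
  exact ⟨n, (π.restrictScalars F).comp Algebra.TensorProduct.includeRight,
    span_range_eq_top hπ, h⟩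

theorem eq_zero_of_trace_map_mul {F A : Type*} (K : Type*) [Field F] [Field K] [IsAlgClosed K]
    [Algebra F K] [Ring A] [Algebra F A] [FiniteDimensional F A] [IsSemisimpleRing A]
    {a : A} (h : ∀ (n : ℕ) (φ : A →ₐ[F] Matrix (Fin n) (Fin n) K) (x : A),
      (φ (a * x)).trace = 0) : a = 0 := by
  by_contra ha
  obtain ⟨n, φ, hφ, hne⟩ := exists_algHom_matrix (F := F) K ha
  have key (y : Matrix (Fin n) (Fin n) K) : (φ a * y).trace = 0 := by
    have hy : y ∈ Submodule.span K (Set.range φ) := hφ ▸ Submodule.mem_top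
    induction hy using Submodule.span_induction with
    | mem _ hx => obtain ⟨x, rfl⟩ := hx; rw [← map_mul, h]
    | zero => simp
    | add x y _ _ hx hy => rw [mul_add, Matrix.trace_add, hx, hy, add_zero]
    | smul k x _ hx => rw [Matrix.mul_smul, Matrix.trace_smul, hx, smul_zero]
  exact hne (Matrix.ext_iff_trace_mul_right.2 fun y => by simpa using key y)

theorem trace_map_eq_zero_of_mem_span {F A K : Type*} [Field F] [Field K]
    [Algebra F K] [Ring A] [Algebra F A] {n : ℕ} (φ : A →ₐ[F] Matrix (Fin n) (Fin n) K) {z : A}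
    (hz : z ∈ Submodule.span F {z : A | ∃ u v : A, z = u * v - v * u}) : (φ z).trace = 0 := by
  induction hz using Submodule.span_induction with
  | mem _ hx =>
    obtain ⟨u, v, rfl⟩ := hx
    rw [map_sub, map_mul, map_mul, Matrix.trace_sub, Matrix.trace_mul_comm, sub_self]
  | zero => simp
  | add x y _ _ hx hy => rw [map_add, Matrix.trace_add, hx, hy, add_zero]
  | smul k x _ hx => rw [map_smul, Matrix.trace_smul, hx, smul_zero]

theorem commute_of_ad_pow_four_eq_zero {R : Type*} [Ring R] {e y : R} (he : IsIdempotentElem e)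
    (h : e * y - 4 * (e * y * e) + 6 * (e * y * e) - 4 * (e * y * e) + y * e = 0) :
    Commute y e := by
  rw [IsIdempotentElem] at he
  rw [commute_iff_eq]
  linear_combination (norm := noncomm_ring) h * e - e * h - y * he + he * y
    + 2 * e * y * he - 2 * he * y * e

theorem central_map_one_of_jordan_identity {F A : Type*} [Field F] [Ring A] [Algebra F A]
    [FiniteDimensional F A] [IsSemisimpleRing A] (h2 : (2 : F) ≠ 0) (D : A →ₗ[F] A)
    (hD : ∀ x y, 2 * D (x * y + y * x) = 2 * (x * D y + D y * x + y * D x + D x * y)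
      - (D 1 * (x * y + y * x) + (x * y + y * x) * D 1)) (a : A) : D 1 * a = a * D 1 := by
  rw [← sub_eq_zero]
  by_contra ha
  let K := AlgebraicClosure F
  obtain ⟨n, π, hπ, hne⟩ := exists_algHom_matrix_map_ne_zero (F := F) K ha
  let E : K ⊗[F] A →ₗ[K] K ⊗[F] A := D.baseChange K
  have hE1 : E 1 = 1 ⊗ₜ D 1 := by simp [E, Algebra.TensorProduct.one_def]
  have hE (x y) : 2 * E (x * y + y * x) = 2 * (x * E y + E y * x + y * E x + E x * y)
      - (E 1 * (x * y + y * x) + (x * y + y * x) * E 1) := by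
    rw [hE1]
    induction x using TensorProduct.induction_on with
    | zero => simp
    | add x x' hx hx' =>
      simp only [add_mul, mul_add, map_add] at hx hx' ⊢
      linear_combination (norm := noncomm_ring) hx + hx'
    | tmul k x =>
      induction y using TensorProduct.induction_on with
      | zero => simp
      | add y y' hy hy' =>
        simp only [add_mul, mul_add, map_add] at hy hy' ⊢
        linear_combination (norm := noncomm_ring) hy + hy'
      | tmul l y =>
        have := congr_arg (fun c : A => (k * l) ⊗ₜ[F] c) (hD x y)
        simp only [two_mul, TensorProduct.tmul_add, TensorProduct.tmul_sub] at this
        simpa [E, two_mul, mul_comm l k, ← TensorProduct.tmul_add,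
          TensorProduct.tmul_sub] using this
  have h2K : (2 : K) ≠ 0 := by
    simpa only [map_ofNat, map_zero] using (algebraMap F K).injective.ne h2
  have ht (b : K ⊗[F] A) (hb : b + b = 0) : b = 0 :=
    (smul_eq_zero_iff_right h2K).1 (by rw [two_smul, hb])
  have hcomm (m) (hm : IsIdempotentElem m) : Commute (π (E 1)) m := by
    obtain ⟨x, rfl⟩ := hπ m
    have h4 := congr_arg π (ad_pow_four_apply_one ht E.toAddMonoidHom hE x)
    simp only [map_sub, map_add, map_mul, map_pow, map_zero, map_ofNat,
      LinearMap.toAddMonoidHom_coe, hm.pow_succ_eq] at h4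
    exact commute_of_ad_pow_four_eq_zero hm h4
  have hall (m) : Commute (π (E 1)) m := by
    rw [Matrix.matrix_eq_sum_single m]
    refine Commute.sum_right _ _ _ fun i _ => Commute.sum_right _ _ _ fun j _ => ?_
    simpa using (Matrix.commute_of_commute_idempotent hcomm i j).smul_right (m i j)
  apply hne
  have := (hall (π (1 ⊗ₜ a))).eq
  rw [← sub_eq_zero, ← map_mul, ← map_mul, ← map_sub, hE1] at this
  simpa [TensorProduct.tmul_sub] using this

theorem trace_form_jordan_identity {R V : Type*} [Ring R] [CommRing V]
    (h2 : ∀ v : V, v + v = 0 → v = 0) (τ : R →+ V) (hτ : ∀ x y, τ (x * y) = τ (y * x))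
    (D : R →+ R) (h : ∀ x, τ (x * D x * x) = 0) (x y : R) :
    τ ((2 * D (x * x) - 2 * (x * D x + D x * x) + (D 1 * (x * x) + x * x * D 1)) * y) = 0 := by
  have polar (x y) : τ (y * D x * x) + τ (x * D y * x) + τ (x * D x * y) = 0 := by
    have e1 := h (x + y)
    have e2 := h (x - y)
    simp only [map_add, map_sub, add_mul, mul_add, sub_mul, mul_sub, h] at e1 e2
    apply h2
    rw [← sub_eq_zero.2 (e1.trans e2.symm)]
    abel
  have polar_one (x y) : τ (y * D 1 * x) + τ (y * D x) + τ (x * D y) + τ (D y * x)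
      + τ (x * D 1 * y) + τ (D x * y) = 0 := by
    have e := polar (x + 1) y
    have e1 := polar x y
    have e2 := polar 1 y
    simp only [map_add, add_mul, mul_add, mul_one, one_mul] at e e1 e2
    linear_combination e - e1 - e2
  have e := polar_one (x * x) y
  have e1 := polar x y
  have e2 := hτ (D 1) (x * x * y)
  rw [hτ (y * D 1), hτ y, hτ (x * x) (D y), mul_assoc (x * x) (D 1), ← mul_assoc (x * x) (D 1)] at e
  rw [mul_assoc y, hτ y, hτ (x * D y) x, ← mul_assoc x x, hτ (x * x)] at e1
  simp only [map_add, map_sub, add_mul, sub_mul, mul_add, two_mul, ← mul_assoc] at e e1 e2 ⊢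
  linear_combination e - e1 - e1 + e2

theorem eq_zero_of_central_of_mul_cube_mem_span {F A : Type*} [Field F] [Ring A] [Algebra F A]
    [FiniteDimensional F A] [IsSemisimpleRing A] (h2 : (2 : F) ≠ 0) {c : A}
    (hc : ∀ x, c * x = x * c)
    (h : ∀ x, c * (x * x * x) ∈ Submodule.span F {z : A | ∃ u v : A, z = u * v - v * u}) :
    c = 0 := by
  let K := AlgebraicClosure F
  have h2K : (2 : K) ≠ 0 := by
    simpa only [map_ofNat, map_zero] using (algebraMap F K).injective.ne h2
  by_cases h3 : (3 : K) = 0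
  · by_contra hc0
    obtain ⟨n, φ, hφ, hne⟩ := exists_algHom_matrix (F := F) K hc0
    have mem_span (X) : X ∈ Submodule.span K (Set.range φ) := hφ ▸ Submodule.mem_top
    have hcomm (X) : φ c * X = X * φ c := by
      induction mem_span X using Submodule.span_induction with
      | mem _ hx => obtain ⟨x, rfl⟩ := hx; rw [← map_mul, hc, map_mul]
      | zero => simp
      | add x y _ _ hx hy => rw [mul_add, add_mul, hx, hy]
      | smul k x _ hx => rw [mul_smul_comm, smul_mul_assoc, hx]
    have hcube (X) : (φ c * (X * X * X)).trace = 0 := by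
      induction mem_span X using Submodule.span_induction with
      | mem _ hx =>
        obtain ⟨x, rfl⟩ := hx
        simpa only [map_mul] using trace_map_eq_zero_of_mem_span φ (h x)
      | zero => simp
      | add X Y _ _ hX hY =>
        have cyc (X Y : Matrix (Fin n) (Fin n) K) :
            (φ c * (X * Y)).trace = (φ c * (Y * X)).trace := by
          rw [← mul_assoc, Matrix.trace_mul_comm, ← mul_assoc, ← hcomm, mul_assoc]
        have e1 := cyc (X * Y) X
        have e2 := cyc Y (X * X)
        have e3 := cyc (Y * X) Y
        have e4 := cyc X (Y * Y)
        simp only [add_mul, mul_add, Matrix.trace_add, ← mul_assoc] at *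
        linear_combination hX + hY + e1 + e2 + e3 + e4
          + h3 * ((φ c * X * X * Y).trace + (φ c * Y * Y * X).trace)
      | smul k X _ hX =>
        simp only [mul_smul_comm, smul_mul_assoc, Matrix.trace_smul, hX, smul_zero]
    have hidem (e) (he : IsIdempotentElem e) : (φ c * e).trace = 0 := by
      simpa only [he.eq] using hcube e
    have hsingle (i j) : (φ c * Matrix.single i j 1).trace = 0 := by
      have hi := hidem (.single i i 1) (by simp [IsIdempotentElem])
      by_cases hij : i = j
      · exact hij ▸ hi
      · have := hidem (.single i i 1 + .single i j 1) (by
          simp [IsIdempotentElem, mul_add, add_mul, Ne.symm hij])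
        rwa [mul_add, Matrix.trace_add, hi, zero_add] at this
    refine hne (Matrix.ext fun i j => ?_)
    simpa [Matrix.trace_mul_single] using hsingle j i
  · refine eq_zero_of_trace_map_mul (F := F) K fun n φ x => ?_
    have q (x : A) : (φ (c * (x * x * x))).trace = 0 := trace_map_eq_zero_of_mem_span φ (h x)
    have e1 := q (1 + x)
    have e2 := q (1 - x)
    have e3 := q x
    simp only [add_mul, mul_add, sub_mul, mul_sub, mul_one, one_mul, map_add, map_sub,
      Matrix.trace_add, Matrix.trace_sub] at e1 e2 e3
    have : (2 * 3 : K) * (φ (c * x)).trace = 0 := by linear_combination e1 - e2 - 2 * e3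
    exact (mul_eq_zero.1 this).resolve_left (mul_ne_zero h2K h3)

theorem exists_central_idempotent_of_mul_mem_right {A : Type*} [Ring A] [IsSemisimpleRing A]
    (I : Ideal A) (hI : ∀ x y, x ∈ I → x * y ∈ I) :
    ∃ e, e * e = e ∧ (∀ x, x ∈ I ↔ x * e = x) ∧ ∀ x, e * x = x * e := by
  obtain ⟨e, he, rfl⟩ := IsSemisimpleRing.ideal_eq_span_idempotent I
  have mem_iff (x) : x ∈ Ideal.span {e} ↔ x * e = x := by
    rw [Ideal.mem_span_singleton']
    constructor
    · rintro ⟨a, rfl⟩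
      rw [mul_assoc, he.eq]
    · exact fun h => ⟨x, h⟩
  have hmul (x) : e * x * e = e * x :=
    (mem_iff _).1 (hI e x (Ideal.mem_span_singleton_self e))
  refine ⟨e, he.eq, mem_iff, fun x => ?_⟩
  have : x * e - e * x = 0 := IsSemisimpleRing.eq_zero_of_mul_mul_self _ fun y => by
    have h1 : e * (x * e - e * x) = 0 := by
      rw [mul_sub, ← mul_assoc, ← mul_assoc, he.eq, hmul, sub_self]
    have h2 : (x * e - e * x) * e = x * e - e * x := by
      rw [sub_mul, mul_assoc, he.eq, hmul]
    calc (x * e - e * x) * y * (x * e - e * x)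
        = (x * e - e * x) * e * y * (x * e - e * x) := by rw [h2]
      _ = (x * e - e * x) * (e * y * (x * e - e * x)) := by simp only [mul_assoc]
      _ = (x * e - e * x) * (e * y * e * (x * e - e * x)) := by rw [hmul]
      _ = 0 := by rw [mul_assoc (e * y), h1, mul_zero, mul_zero]
  exact (sub_eq_zero.1 this).symm

theorem exists_sum_mul_mul_of_center_linear {F A : Type*} [Field F] [Ring A] [Algebra F A]
    [FiniteDimensional F A] [IsSemisimpleRing A] (f : A →ₗ[F] A)
    (hf : ∀ z x, (∀ y, z * y = y * z) → f (z * x) = z * f x) :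
    ∃ (k : ℕ) (a b : Fin k → A), ∀ x, f x = ∑ i, a i * x * b i := by
  let μ := AlgHom.mulLeftRight F A
  let _ : Module (A ⊗[F] Aᵐᵒᵖ) A := Module.compHom A μ.toRingHom
  have smul_def (t : A ⊗[F] Aᵐᵒᵖ) (x : A) : t • x = μ t x := rfl
  have tmul_smul (a b x : A) : (a ⊗ₜ[F] MulOpposite.op b) • x = a * x * b := by
    rw [smul_def, AlgHom.mulLeftRight_apply, MulOpposite.unop_op]
  have : IsSemisimpleModule (A ⊗[F] Aᵐᵒᵖ) A := by
    refine (isSemisimpleModule_iff _ _).2 ⟨fun N => ?_⟩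
    let I : Ideal A :=
      { N.toAddSubmonoid with
        smul_mem' := fun a x hx => by
          have := N.smul_mem (a ⊗ₜ MulOpposite.op 1) hx
          rwa [tmul_smul, mul_one] at this }
    have mul_mem_right (x y : A) (hx : x ∈ I) : x * y ∈ I := by
      have := N.smul_mem (1 ⊗ₜ MulOpposite.op y) hx
      rwa [tmul_smul, one_mul] at this
    obtain ⟨e, hee, hI, he⟩ := exists_central_idempotent_of_mul_mem_right I mul_mem_right
    let N' : Submodule (A ⊗[F] Aᵐᵒᵖ) A :=
      { carrier := {x | x * e = 0}
        add_mem' := fun {x y} hx hy => by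
          rw [Set.mem_ofPred_eq] at hx hy ⊢
          rw [add_mul, hx, hy, add_zero]
        zero_mem' := zero_mul e
        smul_mem' := fun t x hx => by
          rw [Set.mem_ofPred_eq] at hx ⊢
          induction t using TensorProduct.induction_on with
          | zero => rw [smul_def, map_zero, LinearMap.zero_apply, zero_mul]
          | add s t hs ht => rw [add_smul, add_mul, hs, ht, add_zero]
          | tmul a b =>
            rw [← MulOpposite.op_unop b, tmul_smul, mul_assoc, ← he, mul_assoc, ← mul_assoc x,
              hx, zero_mul, mul_zero] }
    refine ⟨N', Submodule.disjoint_def.2 fun x hx hx' => ?_, codisjoint_iff.2 ?_⟩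
    · exact ((hI x).1 hx).symm.trans hx'
    · rw [eq_top_iff]
      rintro x -
      rw [← add_sub_cancel (x * e) x]
      have hxe : x * e * e = x * e := by rw [mul_assoc, hee]
      refine Submodule.add_mem_sup ((hI _).2 hxe) ?_
      change (x - x * e) * e = 0
      rw [sub_mul, hxe, sub_self]
  have map_eq (g : Module.End (A ⊗[F] Aᵐᵒᵖ) A) (x : A) : g x = g 1 * x := by
    have := g.map_smul ((1 : A) ⊗ₜ[F] MulOpposite.op x) 1
    rwa [tmul_smul, tmul_smul, mul_one, one_mul, one_mul] at this
  have map_eq' (g : Module.End (A ⊗[F] Aᵐᵒᵖ) A) (x : A) : g x = x * g 1 := by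
    have := g.map_smul (x ⊗ₜ[F] MulOpposite.op (1 : A)) 1
    rwa [tmul_smul, tmul_smul, mul_one, mul_one, mul_one] at this
  let f' : Module.End (Module.End (A ⊗[F] Aᵐᵒᵖ) A) A :=
    { f.toAddMonoidHom with
      map_smul' := fun g x => by
        change f (g x) = g (f x)
        rw [map_eq, map_eq g (f x)]
        exact hf _ _ fun y => by rw [← map_eq, map_eq'] }
  obtain ⟨s, hs⟩ := Module.Finite.fg_top (R := F) (M := A)
  obtain ⟨t, ht⟩ := jacobson_density f' s
  have hft (x) : f x = μ t x := by
    have hx : x ∈ Submodule.span F (s : Set A) := hs ▸ Submodule.mem_top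
    exact LinearMap.eqOn_span (f := f) (g := μ t) (fun m hm => ht m hm) hx
  obtain ⟨S, hS⟩ := TensorProduct.exists_finset t
  let e := S.equivFin.symm
  refine ⟨_, fun i => (e i).1.1, fun i => (e i).1.2.unop, fun x => ?_⟩
  rw [hft, hS, map_sum, LinearMap.sum_apply, e.sum_comp fun p => p.1.1 * x * p.1.2.unop,
    ← Finset.sum_coe_sort]
  simp [μ]

theorem exists_center_linear_retraction (F A : Type*) [Field F] [Ring A] [Algebra F A]
    [FiniteDimensional F A] [IsSemisimpleRing A] :
    ∃ f : A →ₗ[F] A, (∀ z x, (∀ y, z * y = y * z) → f (z * x) = z * f x) ∧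
      (∀ x y, f x * y = y * f x) ∧ f 1 = 1 := by
  let Z := Subalgebra.center F A
  have : IsArtinianRing Z := IsArtinianRing.of_finite F Z
  have : IsReduced Z := (isReduced_iff_pow_one_lt 2 one_lt_two).2 fun z hz => by
    refine Subtype.ext (IsSemisimpleRing.eq_zero_of_mul_mul_self _ fun x => ?_)
    have hz' : (z : A) * z = 0 := by simpa [pow_two] using congr_arg Subtype.val hz
    rw [← Subalgebra.mem_center_iff.1 z.2 x, mul_assoc, hz', mul_zero]
  have : IsSemisimpleRing Z := IsArtinianRing.isSemisimpleRing_of_isReduced Z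
  obtain ⟨g, hg⟩ := IsSemisimpleModule.extension_property (R := Z) (M := A) (P := Z)
    { toFun := Subtype.val, map_add' := fun _ _ => rfl, map_smul' := fun _ _ => rfl }
    Subtype.val_injective LinearMap.id
  refine ⟨Z.val.toLinearMap ∘ₗ g.restrictScalars F, fun z x hz => ?_, fun x y => ?_, ?_⟩
  · exact congr_arg Subtype.val (g.map_smul ⟨z, Subalgebra.mem_center_iff.2 fun y => (hz y).symm⟩ x)
  · exact (Subalgebra.mem_center_iff.1 (g x).2 y).symm
  · have := LinearMap.congr_fun hg 1
    simpa using congr_arg Subtype.val this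

theorem derivation_inner_of_center_linear {F A : Type*} [Field F] [Ring A] [Algebra F A]
    [FiniteDimensional F A] [IsSemisimpleRing A] (δ : A →ₗ[F] A)
    (hδ : ∀ x y, δ (x * y) = δ x * y + x * δ y) (hz : ∀ z, (∀ y, z * y = y * z) → δ z = 0) :
    ∃ a, ∀ x, δ x = a * x - x * a := by
  obtain ⟨k, a, b, hab⟩ := exists_sum_mul_mul_of_center_linear δ fun z x h => by
    rw [hδ, hz z h, zero_mul, zero_add]
  obtain ⟨f, hf, hfc, hf1⟩ := exists_center_linear_retraction F A
  obtain ⟨l, c, d, hcd⟩ := exists_sum_mul_mul_of_center_linear f hf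
  refine ⟨-∑ i, f (a i) * b i, fun y => ?_⟩
  calc δ y = f 1 * δ y := by rw [hf1, one_mul]
    _ = ∑ j, c j * (δ (d j * y) - δ (d j) * y) := by
      rw [hcd, Finset.sum_mul]
      refine Finset.sum_congr rfl fun j _ => ?_
      rw [hδ]; noncomm_ring
    _ = ∑ j, ∑ i, c j * a i * d j * (y * b i - b i * y) := by
      refine Finset.sum_congr rfl fun j _ => ?_
      rw [hab, hab, Finset.sum_mul, ← Finset.sum_sub_distrib, Finset.mul_sum]
      exact Finset.sum_congr rfl fun i _ => by noncomm_ring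
    _ = ∑ i, f (a i) * (y * b i - b i * y) := by
      rw [Finset.sum_comm]
      simp only [hcd, Finset.sum_mul]
    _ = _ := by
      simp only [neg_mul, Finset.sum_mul, Finset.mul_sum, mul_neg, sub_neg_eq_add]
      rw [neg_add_eq_sub, ← Finset.sum_sub_distrib]
      refine Finset.sum_congr rfl fun i _ => ?_
      rw [mul_sub, ← mul_assoc, hfc]; noncomm_ring

theorem mul_mul_mem_span_commutators {F A : Type*} [Field F] [Ring A] [Algebra F A] (a x : A) :
    x * (a * x - x * a) * x ∈ Submodule.span F {z : A | ∃ u v : A, z = u * v - v * u} :=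
  Submodule.subset_span ⟨x * a * x, x, by noncomm_ring⟩

theorem central_mul_mem_span_commutators {F A : Type*} [Field F] [Ring A] [Algebra F A]
    {c z : A} (hc : ∀ x, c * x = x * c)
    (hz : z ∈ Submodule.span F {z : A | ∃ u v : A, z = u * v - v * u}) :
    c * z ∈ Submodule.span F {z : A | ∃ u v : A, z = u * v - v * u} := by
  induction hz using Submodule.span_induction with
  | mem _ h =>
    obtain ⟨u, v, rfl⟩ := h
    refine Submodule.subset_span ⟨c * u, v, ?_⟩
    rw [mul_sub, ← mul_assoc v, ← hc v]
    simp only [mul_assoc]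
  | zero => rw [mul_zero]; exact zero_mem _
  | add x y _ _ hx hy => rw [mul_add]; exact add_mem hx hy
  | smul k x _ hx => rw [mul_smul_comm]; exact Submodule.smul_mem _ _ hx

theorem jordan_identity_of_mem_span {F A : Type*} [Field F] [Ring A]
    [Algebra F A] [FiniteDimensional F A] [IsSemisimpleRing A] (h2 : (2 : F) ≠ 0)
    (D : A →ₗ[F] A)
    (h : ∀ x : A, x * D x * x ∈ Submodule.span F {z : A | ∃ u v : A, z = u * v - v * u}) (x : A) :
    2 * D (x * x) - 2 * (x * D x + D x * x) + (D 1 * (x * x) + x * x * D 1) = 0 := by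
  let K := AlgebraicClosure F
  have h2K : (2 : K) ≠ 0 := by
    simpa only [map_ofNat, map_zero] using (algebraMap F K).injective.ne h2
  refine eq_zero_of_trace_map_mul (F := F) K fun n φ y => ?_
  refine trace_form_jordan_identity (fun v hv => ?_)
    ((Matrix.traceAddMonoidHom (Fin n) K).comp φ.toRingHom.toAddMonoidHom) (fun x y => ?_)
    D.toAddMonoidHom (fun x => trace_map_eq_zero_of_mem_span φ (h x)) x y
  · rw [← two_mul] at hv
    exact (mul_eq_zero.1 hv).resolve_left h2K
  · change (φ (x * y)).trace = (φ (y * x)).trace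
    rw [map_mul, map_mul, Matrix.trace_mul_comm]

theorem sub_mulLeft_derivation {F A : Type*} [Field F] [Ring A]
    [Algebra F A] [IsSemisimpleRing A] (h2 : (2 : F) ≠ 0)
    (D : A →ₗ[F] A) (hc : ∀ x, D 1 * x = x * D 1)
    (h : ∀ x, 2 * D (x * x) - 2 * (x * D x + D x * x) + (D 1 * (x * x) + x * x * D 1) = 0)
    (x y : A) :
    (D - LinearMap.mulLeft F (D 1)) (x * y) =
      (D - LinearMap.mulLeft F (D 1)) x * y + x * (D - LinearMap.mulLeft F (D 1)) y := by
  have h2A (b : A) (hb : b + b = 0) : b = 0 := by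
    rw [← two_smul F] at hb
    exact (smul_eq_zero.1 hb).resolve_left h2
  refine jordan_derivation_map_mul (δ := (D - LinearMap.mulLeft F (D 1)).toAddMonoidHom) h2A
    IsSemisimpleRing.eq_zero_of_mul_mul_self (fun x => ?_) x y
  change D (x * x) - D 1 * (x * x) = x * (D x - D 1 * x) + (D x - D 1 * x) * x
  refine sub_eq_zero.1 (h2A _ ?_)
  have h1 := hc x
  have h3 := hc (x * x)
  linear_combination (norm := noncomm_ring) h x + h3 - 2 * h1 * x

theorem mul_cube_of_central {R : Type*} [Ring R] {z e : R} (hz : ∀ x, z * x = x * z)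
    (he : ∀ x, e * x = x * e) (x w : R) :
    z * x * (z * w + e * x) * (z * x) - z * z * z * (x * w * x) = z * z * e * (x * x * x) := by
  linear_combination (norm := noncomm_ring) -z * hz x * w * z * x - z * z * x * hz w * x
    - z * z * hz x * w * x - z * he x * x * z * x - z * e * hz (x * x) * x
    + z * he z * x * x * x

theorem derivation_eq_zero_of_central {F A : Type*} [Field F] [Ring A]
    [Algebra F A] [FiniteDimensional F A] [IsSemisimpleRing A] (h2 : (2 : F) ≠ 0)
    {δ : A →ₗ[F] A} (hδ : ∀ x y, δ (x * y) = δ x * y + x * δ y) {d : A} (hd : ∀ x, d * x = x * d)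
    (h : ∀ x, x * (d * x + δ x) * x ∈
      Submodule.span F {z : A | ∃ u v : A, z = u * v - v * u})
    {z : A} (hz : ∀ x, z * x = x * z) : δ z = 0 := by
  have key (z : A) (hz : ∀ x, z * x = x * z) : z * z * δ z = 0 := by
    have hδz (x) : δ z * x = x * δ z := by
      have e := congr_arg δ (hz x)
      rw [hδ, hδ] at e
      linear_combination (norm := noncomm_ring) e - hz (δ x)
    refine eq_zero_of_central_of_mul_cube_mem_span (F := F) h2 (fun x => ?_) fun x => ?_
    · have hzx : Commute z x := hz x
      exact ((hzx.mul_left hzx).mul_left (hδz x)).eq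
    · have hz3 (x) : z * z * z * x = x * (z * z * z) := by
        have hzx : Commute z x := hz x
        exact ((hzx.mul_left hzx).mul_left hzx).eq
      have e := sub_mem (h (z * x)) (central_mul_mem_span_commutators hz3 (h x))
      convert e using 1
      have hw : d * (z * x) + δ (z * x) = z * (d * x + δ x) + δ z * x := by
        rw [hδ, ← mul_assoc, hd z]; noncomm_ring
      rw [hw]
      exact (mul_cube_of_central hz hδz x (d * x + δ x)).symm
  have hδ1 : δ 1 = 0 := by
    have := hδ 1 1
    simpa using this
  have e := key z hz
  have e1 := key (z + 1) fun x => by rw [add_mul, mul_add, hz, one_mul, mul_one]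
  rw [map_add, hδ1, add_zero] at e1
  have h0 : z * δ z = 0 := by
    have : z * ((z + 1) * (z + 1) * δ z) = 0 := by rw [e1, mul_zero]
    linear_combination (norm := noncomm_ring) this - z * e - 2 * e
  linear_combination (norm := noncomm_ring) e1 - e - 2 * h0

/-- **Corollary 2.6.** Let `A` be a finite-dimensional semisimple algebra over a field `F`
with `char F ≠ 2`. A linear map `D : A → A` satisfies `x * D x * x ∈ [A,A]` for every
`x ∈ A` if and only if `D` is an inner derivation. -/
theorem mem_commutator_span_iff_inner_derivation (F A : Type*) [Field F] [Ring A]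
    [Algebra F A] [FiniteDimensional F A] [IsSemisimpleRing A] (h2 : (2 : F) ≠ 0)
    (D : A →ₗ[F] A) :
    (∀ x : A, x * D x * x ∈ Submodule.span F {z : A | ∃ u v : A, z = u * v - v * u}) ↔
      ∃ a : A, ∀ x : A, D x = a * x - x * a := by
  refine ⟨fun h => ?_, fun ⟨a, ha⟩ x => ha x ▸ mul_mul_mem_span_commutators a x⟩
  have hJ := jordan_identity_of_mem_span h2 D h
  have hd : ∀ x, D 1 * x = x * D 1 :=
    central_map_one_of_jordan_identity h2 D fun x y => by
      have e := hJ (x + y)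
      rw [map_add]
      simp only [mul_add, add_mul, map_add] at e
      linear_combination (norm := noncomm_ring) e - hJ x - hJ y
  have hδ := sub_mulLeft_derivation h2 D hd hJ
  have hD (x) : D x = D 1 * x + (D - LinearMap.mulLeft F (D 1)) x :=
    (add_sub_cancel (D 1 * x) (D x)).symm
  obtain ⟨a, ha⟩ := derivation_inner_of_center_linear _ hδ fun z hz =>
    derivation_eq_zero_of_central h2 hδ hd (fun x => by rw [← hD]; exact h x) hz
  have hd0 : D 1 = 0 := by
    refine eq_zero_of_central_of_mul_cube_mem_span h2 hd fun x => ?_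
    convert sub_mem (h x) (mul_mul_mem_span_commutators (F := F) a x) using 1
    rw [hD x, ha]
    linear_combination (norm := noncomm_ring) hd x * x * x
  exact ⟨a, fun x => by rw [hD x, ha, hd0, zero_mul, zero_add]⟩
end

section
/- Let A be a finite-dimensional semisimple algebra over a field F with char(F) ≠ 2. If D : A → A is a linear map such that for every x ∈ A there exists a_x ∈ A with D(x) = a_x x − x a_x (a local inner derivation), then D itself is an inner derivation: there exists a ∈ A such that D(x) = ax − xa for all x ∈ A. -/
open TensorProduct

section Jordan

variable {A : Type*} [Ring A]

theorem jordan_mul_add_mul_s5 {D : A →+ A} (hD : ∀ x, D (x * x) = D x * x + x * D x) (x y : A) :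
    D (x * y) + D (y * x) = D x * y + x * D y + D y * x + y * D x := by
  have h := hD (x + y)
  simp only [mul_add, add_mul, map_add, hD] at h
  linear_combination (norm := noncomm_ring) h

theorem jordan_mul_mul_self {D : A →+ A} (h2 : ∀ x : A, x + x = 0 → x = 0)
    (hD : ∀ x, D (x * x) = D x * x + x * D x) (x y : A) :
    D (x * y * x) = D x * y * x + x * D y * x + x * y * D x := by
  have h₁ := jordan_mul_add_mul_s5 hD x (x * y + y * x)
  have h₂ := jordan_mul_add_mul_s5 hD (x * x) y
  have h₃ := jordan_mul_add_mul_s5 hD x y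
  rw [map_add, h₃] at h₁
  rw [hD] at h₂
  simp only [mul_add, add_mul, map_add, ← mul_assoc] at h₁ h₂
  refine sub_eq_zero.mp (h2 _ ?_)
  linear_combination (norm := noncomm_ring) h₁ - h₂

theorem jordan_mul_mul_add_s5 {D : A →+ A} (h2 : ∀ x : A, x + x = 0 → x = 0)
    (hD : ∀ x, D (x * x) = D x * x + x * D x) (x y z : A) :
    D (x * y * z) + D (z * y * x) = D x * y * z + x * D y * z + x * y * D z +
      D z * y * x + z * D y * x + z * y * D x := by
  have h := jordan_mul_mul_self h2 hD (x + z) y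
  simp only [mul_add, add_mul, map_add, jordan_mul_mul_self h2 hD] at h
  linear_combination (norm := noncomm_ring) h

theorem jordan_defect_mul_commutator {D : A →+ A} (h2 : ∀ x : A, x + x = 0 → x = 0)
    (hD : ∀ x, D (x * x) = D x * x + x * D x) (x y r : A) :
    (D (x * y) - D x * y - x * D y) * r * (x * y - y * x) +
      (x * y - y * x) * r * (D (x * y) - D x * y - x * D y) = 0 := by
  have h₁ := jordan_mul_mul_add_s5 h2 hD (x * y) r (y * x)
  have h₂ := jordan_mul_mul_self h2 hD x (y * r * y)
  have h₃ := jordan_mul_mul_self h2 hD y (x * r * x)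
  have h₄ : D (y * x) = D x * y + x * D y + D y * x + y * D x - D (x * y) :=
    eq_sub_of_add_eq' (jordan_mul_add_mul_s5 hD x y)
  rw [jordan_mul_mul_self h2 hD y r] at h₂
  rw [jordan_mul_mul_self h2 hD x r] at h₃
  rw [h₄] at h₁
  simp only [← mul_assoc] at h₁ h₂ h₃
  linear_combination (norm := noncomm_ring) h₁ - h₂ - h₃

theorem mul_mul_eq_zero_of_mul_mul_add {a b : A} (h2 : ∀ x : A, x + x = 0 → x = 0)
    (hs : ∀ a : A, (∀ r, a * r * a = 0) → a = 0)
    (h : ∀ r, a * r * b + b * r * a = 0) (r : A) : a * r * b = 0 := by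
  refine hs _ fun s => h2 _ ?_
  have h₁ := congr(a * r * $(h s) * r * b)
  have h₂ := congr($(h (r * a * s)) * r * b)
  have h₃ := congr($(h r) * s * (a * r * b))
  linear_combination (norm := noncomm_ring) h₁ - h₂ + h₃

theorem jordan_derivation_of_prime {D : A →+ A} (h2 : ∀ x : A, x + x = 0 → x = 0)
    (hp : ∀ a b : A, (∀ r, a * r * b = 0) → a = 0 ∨ b = 0)
    (hD : ∀ x, D (x * x) = D x * x + x * D x)
    (hc : ∀ z, (∀ x, x * z = z * x) → D z = 0) (x y : A) :
    D (x * y) = D x * y + x * D y := by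
  have key (x y : A) : D (x * y) - D x * y - x * D y = 0 ∨ x * y - y * x = 0 :=
    hp _ _ <| mul_mul_eq_zero_of_mul_mul_add h2 (fun a ha => (hp a a ha).elim id id)
      (jordan_defect_mul_commutator h2 hD x y)
  by_contra hne
  have hxy : D (x * y) - D x * y - x * D y ≠ 0 := fun h => hne (by
    linear_combination (norm := noncomm_ring) h)
  have hcomm := (key x y).resolve_left hxy
  have hx (u : A) : u * x = x * u := by
    by_contra hu
    have hu' : x * u - u * x ≠ 0 := fun h => hu (sub_eq_zero.mp h).symm
    have h₁ := (key x u).resolve_right hu'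
    have h₂ := (key x (y + u)).resolve_right fun h => hu' (by
      linear_combination (norm := noncomm_ring) h - hcomm)
    refine hxy ?_
    rw [mul_add, map_add, map_add] at h₂
    linear_combination (norm := noncomm_ring) h₂ - h₁
  have h := jordan_mul_add_mul_s5 hD x y
  rw [hx y, hx (D y), hc x hx] at h
  refine hxy (h2 _ ?_)
  rw [hc x hx]
  linear_combination (norm := noncomm_ring) h

end Jordan

theorem IsSimpleRing.addSubgroup_eq_top {A : Type*} [Ring A] [IsSimpleRing A] {x : A} (hx : x ≠ 0)
    (S : AddSubgroup A) (hS : ∀ a b, a * x * b ∈ S) : S = ⊤ := by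
  have hone := IsSimpleRing.one_mem_of_ne_zero_mem (TwoSidedIdeal.span {x}) hx
    (TwoSidedIdeal.subset_span rfl)
  refine eq_top_iff.mpr fun y _ => ?_
  have hy : y ∈ TwoSidedIdeal.span {x} := by
    simpa using TwoSidedIdeal.mul_mem_left _ y 1 hone
  rw [TwoSidedIdeal.mem_span_iff_mem_addSubgroup_closure] at hy
  refine (AddSubgroup.closure_le S).mpr ?_ hy
  rintro _ ⟨_, ⟨a, -, _, rfl, rfl⟩, b, -, rfl⟩
  exact hS a b

theorem IsSimpleRing.eq_zero_or_eq_zero_of_forall_mul_mul {A : Type*} [Ring A] [IsSimpleRing A]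
    (a b : A) (h : ∀ r, a * r * b = 0) : a = 0 ∨ b = 0 := by
  refine or_iff_not_imp_right.mpr fun hb => ?_
  have hS := IsSimpleRing.addSubgroup_eq_top hb (AddMonoidHom.mulLeft a).ker fun p q => by
    simp [← mul_assoc, h]
  simpa using hS.ge (AddSubgroup.mem_top 1)

theorem IsSimpleRing.exists_sum_mul_mul {F A : Type*} [Field F] [Ring A] [Algebra F A]
    [FiniteDimensional F A] [IsSimpleRing A] (f : A →ₗ[F] A)
    (hf : ∀ z, (∀ x, x * z = z * x) → ∀ x, f (z * x) = z * f x) :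
    ∃ S : Finset (A × Aᵐᵒᵖ), ∀ x, f x = ∑ i ∈ S, i.1 * x * i.2.unop := by
  let M := (AlgHom.mulLeftRight F A).range
  have smul_mem (a b : A) : ∃ m : M, ∀ x : A, m • x = a * x * b :=
    ⟨⟨_, a ⊗ₜ .op b, rfl⟩, fun x => AlgHom.mulLeftRight_apply F A a (.op b) x⟩
  have : IsSimpleModule M A := by
    refine isSimpleModule_iff_toSpanSingleton_surjective.mpr ⟨inferInstance, fun x hx y => ?_⟩
    let S : AddSubgroup A :=
      AddMonoidHom.range (G := M) (LinearMap.toSpanSingleton M A x).toAddMonoidHom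
    have hS : S = ⊤ := IsSimpleRing.addSubgroup_eq_top hx S fun a b => by
      obtain ⟨m, hm⟩ := smul_mem a b
      exact ⟨m, hm x⟩
    exact hS.ge (AddSubgroup.mem_top y)
  have key (φ : Module.End M A) (x : A) : φ x = φ 1 * x ∧ φ x = x * φ 1 := by
    obtain ⟨m, hm⟩ := smul_mem 1 x
    obtain ⟨n, hn⟩ := smul_mem x 1
    exact ⟨by simpa [hm] using φ.map_smul m 1, by simpa [hn] using φ.map_smul n 1⟩
  let g : Module.End (Module.End M A) A :=
    { f with
      map_smul' := fun φ x => by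
        change f (φ x) = φ (f x)
        rw [(key φ x).1, (key φ (f x)).1]
        exact hf _ (fun y => (key φ y).2.symm.trans (key φ y).1) x }
  obtain ⟨s, hs⟩ := Module.Finite.fg_top (R := F) (M := A)
  obtain ⟨⟨_, t, rfl⟩, ht⟩ := jacobson_density (R := M) g s
  obtain ⟨S, rfl⟩ := TensorProduct.exists_finset t
  have hft : f = AlgHom.mulLeftRight F A (∑ i ∈ S, i.1 ⊗ₜ[F] i.2) :=
    LinearMap.ext_on hs fun m hm => ht m hm
  refine ⟨S, fun x => ?_⟩
  simp [hft, AlgHom.mulLeftRight_apply]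

theorem IsSimpleRing.exists_linearMap_center (F A : Type*) [Field F] [Ring A] [Algebra F A]
    [IsSimpleRing A] : ∃ f : A →ₗ[F] A, f 1 = 1 ∧ (∀ x y, y * f x = f x * y) ∧
      ∀ z, (∀ x, x * z = z * x) → ∀ x, f (z * x) = z * f x := by
  let := (IsSimpleRing.isField_center A).toField
  obtain ⟨g, hg⟩ := LinearMap.exists_leftInverse_of_injective
    (LinearMap.toSpanSingleton (Subring.center A) A 1)
    (LinearMap.ker_eq_bot.mpr fun x y h => Subtype.ext <| by
      simpa [Subring.smul_def] using h)
  have hz (z : A) (h : ∀ x, x * z = z * x) (x : A) : (g (z * x) : A) = z * g x :=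
    congr_arg Subtype.val (g.map_smul ⟨z, Subring.mem_center_iff.mpr h⟩ x)
  refine ⟨{ toFun := fun x => g x, map_add' := by simp, map_smul' := fun c x => ?_ },
    ?_, fun x y => Subring.mem_center_iff.mp (g x).2 y, hz⟩
  · rw [Algebra.smul_def, hz _ fun x => (Algebra.commutes c x).symm]
    exact (Algebra.smul_def c _).symm
  · simpa using congr_arg Subtype.val (LinearMap.congr_fun hg 1)

theorem IsSimpleRing.exists_commutator_of_leibniz {F A : Type*} [Field F] [Ring A] [Algebra F A]
    [FiniteDimensional F A] [IsSimpleRing A] (D : A →ₗ[F] A)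
    (hD : ∀ x y, D (x * y) = D x * y + x * D y) (hc : ∀ z, (∀ x, x * z = z * x) → D z = 0) :
    ∃ a, ∀ x, D x = a * x - x * a := by
  obtain ⟨f, hf1, hfc, hfz⟩ := IsSimpleRing.exists_linearMap_center F A
  obtain ⟨S, hS⟩ := IsSimpleRing.exists_sum_mul_mul f hfz
  obtain ⟨T, hT⟩ := IsSimpleRing.exists_sum_mul_mul D fun z hz x => by simp [hD, hc z hz]
  have h₁ (x : A) :
      ∑ i ∈ S, D (x * i.1) * i.2.unop = (∑ j ∈ T, j.1 * f j.2.unop) * x := by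
    simp only [hT, Finset.sum_mul]
    rw [Finset.sum_comm]
    refine Finset.sum_congr rfl fun j _ => ?_
    rw [mul_assoc, ← hfc, hS]
    simp only [Finset.mul_sum, mul_assoc]
  have h₂ := h₁ 1
  refine ⟨∑ j ∈ T, j.1 * f j.2.unop, fun x => ?_⟩
  have h₃ : ∑ i ∈ S, D (x * i.1) * i.2.unop = D x * f 1 + x * ∑ i ∈ S, D (1 * i.1) * i.2.unop := by
    simp only [hS, hD x, Finset.mul_sum, ← Finset.sum_add_distrib, add_mul, mul_assoc, one_mul]
  rw [h₁, h₂, hf1, mul_one, mul_one] at h₃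
  exact eq_sub_of_add_eq h₃.symm

theorem exists_trace_ne_zero (F A : Type*) [Field F] [Ring A] [Nontrivial A] [Algebra F A]
    [FiniteDimensional F A] : ∃ τ : A →ₗ[F] AlgebraicClosure F,
      (∀ x y, τ (x * y) = τ (y * x)) ∧ τ ≠ 0 := by
  let E := AlgebraicClosure F
  let B := E ⊗[F] A
  have : IsArtinianRing B := IsArtinianRing.of_finite E B
  have : Nontrivial (B ⧸ Ring.jacobson B) :=
    Ideal.Quotient.nontrivial_iff.mpr (Ring.jacobson_lt_top B).ne
  obtain ⟨n, d, hd, ⟨e⟩⟩ :=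
    IsSemisimpleRing.exists_algEquiv_pi_matrix_of_isAlgClosed E (B ⧸ Ring.jacobson B)
  have : Nonempty (Fin n) := by
    by_contra hn
    rw [not_nonempty_iff] at hn
    exact not_subsingleton _ e.toEquiv.subsingleton
  let i : Fin n := Classical.arbitrary _
  let p : B →ₐ[E] Matrix (Fin (d i)) (Fin (d i)) E :=
    ((Pi.evalAlgHom E _ i).comp e.toAlgHom).comp (Ideal.Quotient.mkₐ E (Ring.jacobson B))
  have hp : Function.Surjective p := (Function.surjective_eval i).comp
    (e.surjective.comp Ideal.Quotient.mk_surjective)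
  let σ : B →ₗ[E] E := Matrix.traceLinearMap _ E E ∘ₗ p.toLinearMap
  let τ : A →ₗ[F] E :=
    σ.restrictScalars F ∘ₗ (Algebra.TensorProduct.includeRight : A →ₐ[F] B).toLinearMap
  refine ⟨τ, fun x y => ?_, fun h => ?_⟩
  · change Matrix.trace (p (Algebra.TensorProduct.includeRight (x * y))) =
      Matrix.trace (p (Algebra.TensorProduct.includeRight (y * x)))
    rw [map_mul, map_mul, map_mul, map_mul, Matrix.trace_mul_comm]
  · have hσ (b : B) : σ b = 0 := by
      induction b using TensorProduct.induction_on with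
      | zero => simp
      | add x y hx hy => simp [hx, hy]
      | tmul c a =>
        have hca : c ⊗ₜ[F] a = c • (1 : E) ⊗ₜ[F] a := by simp [TensorProduct.smul_tmul']
        have : σ ((1 : E) ⊗ₜ[F] a) = 0 := LinearMap.congr_fun h a
        rw [hca, map_smul, this, smul_zero]
    have := hd i
    obtain ⟨b, hb⟩ := hp (Matrix.single 0 0 1)
    have h₁ : Matrix.trace (p b) = 0 := hσ b
    simp [hb] at h₁

theorem jordan_of_local_inner {F A : Type*} [Field F] [Ring A] [Algebra F A]
    [FiniteDimensional F A] [IsSimpleRing A] (h2 : (2 : F) ≠ 0) (D : A →ₗ[F] A)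
    (hloc : ∀ x : A, ∃ a : A, D x = a * x - x * a) (x : A) :
    D (x * x) = D x * x + x * D x := by
  obtain ⟨τ, hτ, hτ0⟩ := exists_trace_ne_zero F A
  have nondeg (x : A) (hx : ∀ y, τ (x * y) = 0) : x = 0 := by
    by_contra hx0
    have hS := IsSimpleRing.addSubgroup_eq_top hx0 τ.toAddMonoidHom.ker fun a b => by
      simpa [mul_assoc] using (hτ a (x * b)).trans (by rw [mul_assoc, hx])
    exact hτ0 (LinearMap.ext fun y => hS.ge (AddSubgroup.mem_top y))
  have comm (x y : A) (h : x * y = y * x) : τ (D x * y) = 0 := by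
    obtain ⟨a, ha⟩ := hloc x
    rw [ha, sub_mul, map_sub, mul_assoc, h, ← mul_assoc, hτ (a * y) x, mul_assoc, sub_self]
  have skew (x y : A) : τ (D x * y) + τ (D y * x) = 0 := by
    simpa [add_mul, mul_add, comm x x rfl, comm y y rfl, add_comm] using comm (x + y) (x + y) rfl
  have htwo (x : A) (h : x + x = 0) : x = 0 := by
    rw [← two_smul F] at h
    exact (smul_eq_zero.mp h).resolve_left h2
  refine (sub_eq_zero.mp <| htwo _ <| nondeg _ fun y => ?_).symm
  have cube (x : A) : τ (D x * (x * x)) = 0 := comm x (x * x) (mul_assoc x x x).symm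
  have h₁ := cube (x + y)
  have h₂ := cube (x - y)
  have h₃ := cube y
  have h₄ := skew (x * x) y
  have h₅ := hτ x (D x * y)
  simp only [map_add, map_sub, add_mul, mul_add, sub_mul, mul_sub, mul_assoc] at h₁ h₂ h₃ h₄ h₅ ⊢
  linear_combination h₁ - h₂ - 2 * h₃ - 2 * h₄ + 2 * h₅

theorem IsSimpleRing.exists_commutator_of_local_inner {F A : Type*} [Field F] [Ring A]
    [Algebra F A] [FiniteDimensional F A] [IsSimpleRing A] (h2 : (2 : F) ≠ 0) (D : A →ₗ[F] A)
    (hloc : ∀ x : A, ∃ a : A, D x = a * x - x * a) :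
    ∃ a : A, ∀ x : A, D x = a * x - x * a := by
  have hc (z : A) (hz : ∀ x, x * z = z * x) : D z = 0 := by
    obtain ⟨a, ha⟩ := hloc z
    rw [ha, hz, sub_self]
  have htwo (x : A) (h : x + x = 0) : x = 0 := by
    rw [← two_smul F] at h
    exact (smul_eq_zero.mp h).resolve_left h2
  exact IsSimpleRing.exists_commutator_of_leibniz D
    (jordan_derivation_of_prime (D := D.toAddMonoidHom) htwo
      IsSimpleRing.eq_zero_or_eq_zero_of_forall_mul_mul (jordan_of_local_inner h2 D hloc) hc) hc

theorem exists_commutator_of_local_inner_pi {F ι : Type*} [Field F] [Finite ι] {A : ι → Type*}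
    [∀ i, Ring (A i)] [∀ i, Algebra F (A i)] [∀ i, FiniteDimensional F (A i)]
    [∀ i, IsSimpleRing (A i)] (h2 : (2 : F) ≠ 0) (D : (∀ i, A i) →ₗ[F] ∀ i, A i)
    (hloc : ∀ x, ∃ a, D x = a * x - x * a) : ∃ a, ∀ x, D x = a * x - x * a := by
  classical
  have hi (i : ι) : ∃ a : A i, ∀ x : A i, D (Pi.single i x) i = a * x - x * a := by
    refine IsSimpleRing.exists_commutator_of_local_inner h2
      (LinearMap.proj i ∘ₗ D ∘ₗ LinearMap.single F A i) fun x => ?_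
    obtain ⟨a, ha⟩ := hloc (Pi.single i x)
    exact ⟨a i, by simp [ha]⟩
  choose a ha using hi
  refine ⟨a, fun x => funext fun i => ?_⟩
  have h : D (x - Pi.single i (x i)) i = 0 := by
    obtain ⟨b, hb⟩ := hloc (x - Pi.single i (x i))
    simp [hb]
  rw [map_sub, Pi.sub_apply, sub_eq_zero, ha] at h
  exact h

/-- **Corollary 2.9.** Let `A` be a finite-dimensional semisimple algebra over a field `F`
with `char F ≠ 2`. Then every local inner derivation `D : A → A` is an inner derivation. -/
theorem local_inner_derivation_is_inner (F A : Type*) [Field F] [Ring A]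
    [Algebra F A] [FiniteDimensional F A] [IsSemisimpleRing A] (h2 : (2 : F) ≠ 0)
    (D : A →ₗ[F] A) (hloc : ∀ x : A, ∃ a : A, D x = a * x - x * a) :
    ∃ a : A, ∀ x : A, D x = a * x - x * a := by
  obtain ⟨n, K, d, _, _, _, _, ⟨e⟩⟩ :=
    IsSemisimpleRing.exists_algEquiv_pi_matrix_divisionRing_finite F A
  obtain ⟨a, ha⟩ := exists_commutator_of_local_inner_pi h2
    (e.toLinearMap ∘ₗ D ∘ₗ e.symm.toLinearMap) fun x => by
      obtain ⟨a, ha⟩ := hloc (e.symm x)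
      exact ⟨e a, by simp [ha]⟩
  refine ⟨e.symm a, fun x => e.injective ?_⟩
  simpa using ha (e x)
end

section
/- Let A be a finite-dimensional semisimple algebra over a field F with char(F) ≠ 2 and char(F) ≠ 3, with center Z. For a linear map T : A → A the following are equivalent: (i) T(x)³ − x³ ∈ [A,A] for every x ∈ A; (ii) there exist a Jordan automorphism J of A and a central element α ∈ Z with α³ = 1 such that T(x) = α J(x) for all x ∈ A, and moreover J belongs to the multiplication algebra M(A), i.e., there exist finitely many aᵢ, bᵢ ∈ A with J(x) = Σᵢ aᵢ x bᵢ for all x ∈ A. -/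
/-- The linear span of the additive commutators of an algebra. -/
abbrev commutatorSpan (F A : Type*) [CommSemiring F] [Ring A] [Algebra F A] : Submodule F A :=
  Submodule.span F {z : A | ∃ u v : A, z = u * v - v * u}

section Jordan

variable {F A : Type*} [Field F] [Ring A] [Algebra F A]

lemma eq_of_two_mul_eq (h2 : (2 : F) ≠ 0) {x y : A} (h : 2 * x = 2 * y) : x = y := by
  have h' : (2 : F) • x = (2 : F) • y := by
    rw [two_smul, two_smul, ← two_mul, ← two_mul, h]
  exact smul_right_injective A h2 h'

lemma jordan_map_sq (h2 : (2 : F) ≠ 0) {J : A →ₗ[F] A}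
    (hJ : ∀ x y, J (x * y + y * x) = J x * J y + J y * J x) (x : A) :
    J (x * x) = J x * J x := by
  refine eq_of_two_mul_eq h2 ?_
  have := hJ x x
  rwa [map_add, ← two_mul, ← two_mul] at this

lemma jordan_map_sandwich (h2 : (2 : F) ≠ 0) {J : A →ₗ[F] A}
    (hJ : ∀ x y, J (x * y + y * x) = J x * J y + J y * J x) (x y : A) :
    J (x * y * x) = J x * J y * J x := by
  refine eq_of_two_mul_eq h2 ?_
  have h1 := hJ x (x * y + y * x)
  have h3 := hJ (x * x) y
  rw [hJ x y, ← sub_eq_zero] at h1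
  rw [jordan_map_sq h2 hJ, ← sub_eq_zero] at h3
  have h4 : x * (x * y + y * x) + (x * y + y * x) * x
      = 2 * (x * y * x) + (x * x * y + y * (x * x)) := by noncomm_ring
  rw [h4, map_add] at h1
  have h5 : J (2 * (x * y * x)) = 2 * J (x * y * x) := by rw [two_mul, map_add, two_mul]
  rw [h5] at h1
  rw [← sub_eq_zero]
  have h6 := congrArg₂ (· - ·) h1 h3
  simp only [sub_zero] at h6
  rw [← h6]
  noncomm_ring

lemma jordan_map_cube (h2 : (2 : F) ≠ 0) {J : A →ₗ[F] A}
    (hJ : ∀ x y, J (x * y + y * x) = J x * J y + J y * J x) (x : A) :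
    J (x ^ 3) = J x ^ 3 := by
  simpa [pow_succ] using jordan_map_sandwich h2 hJ x x

/-- If `T` maps the Jordan product of an algebra spanned by idempotents to the Jordan product
twisted by `T 1`, then `T 1` is central. -/
lemma map_one_commute_of_span_idempotent [FiniteDimensional F A] (h2 : (2 : F) ≠ 0)
    (hspan : Submodule.span F {e : A | e * e = e} = ⊤) {T : A →ₗ[F] A}
    (hs : Function.Surjective T)
    (hT : ∀ x y, 2 * (T x * T y + T y * T x) = T (x * y + y * x) * T 1 + T 1 * T (x * y + y * x))
    (x : A) : T 1 * x = x * T 1 := by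
  set c := T 1 with hc
  have hsq : ∀ x : A, x * x = 1 → T x * T x = c * c := by
    intro x hx
    have h := hT x x
    rw [hx, map_add, ← hc] at h
    refine eq_of_two_mul_eq h2 (eq_of_two_mul_eq h2 ?_)
    convert h using 1 <;> noncomm_ring
  have hidem : ∀ e : A, e * e = e → c * c * T e = T e * (c * c) := by
    intro e he
    have h1 : (1 - 2 * e) * (1 - 2 * e) = 1 := by
      have : (1 - 2 * e) * (1 - 2 * e) = 1 + 4 * (e * e - e) := by noncomm_ring
      rw [this, he, sub_self, mul_zero, add_zero]
    have h3 := hsq _ h1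
    have h4 : T (1 - 2 * e) = c - 2 * T e := by rw [map_sub, two_mul, map_add, two_mul]
    rw [h4] at h3
    have h5 : c * c * (c - 2 * T e) = (c - 2 * T e) * (c * c) := by
      rw [← h3]; noncomm_ring
    refine eq_of_two_mul_eq h2 ?_
    rw [← sub_eq_zero] at h5 ⊢
    rw [← neg_eq_zero, ← h5]
    noncomm_ring
  have hcent : ∀ x : A, c * c * x = x * (c * c) := by
    intro x
    obtain ⟨y, rfl⟩ := hs x
    have hy : y ∈ Submodule.span F {e : A | e * e = e} := hspan ▸ Submodule.mem_top
    induction hy using Submodule.span_induction with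
    | mem e he => exact hidem e he
    | zero => simp
    | add y z _ _ hy hz => rw [map_add, mul_add, add_mul, hy, hz]
    | smul a y _ hy => rw [map_smul, mul_smul_comm, smul_mul_assoc, hy]
  have hinj : ∀ y : A, c * y + y * c = 0 → y = 0 := by
    let Lc : A →ₗ[F] A := LinearMap.mulLeft F c + LinearMap.mulRight F c
    have hLs : Function.Surjective Lc := by
      intro y
      obtain ⟨u, hu⟩ := hs 1
      obtain ⟨z, rfl⟩ := hs y
      refine ⟨(4 : F)⁻¹ • T (u * z + z * u), ?_⟩
      have h := hT u z
      have h4 : (4 : F) ≠ 0 := by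
        have : (4 : F) = 2 * 2 := by norm_num
        rw [this]; exact mul_ne_zero h2 h2
      rw [map_smul, inv_smul_eq_iff₀ h4]
      simp only [Lc, LinearMap.add_apply, LinearMap.mulLeft_apply, LinearMap.mulRight_apply]
      rw [add_comm, ← h, hu, one_mul, mul_one, ofNat_smul_eq_nsmul]
      noncomm_ring
    have := LinearMap.injective_iff_surjective.2 hLs
    intro y hy
    exact (injective_iff_map_eq_zero Lc).1 this y hy
  have key : c * x * c - c * c * x = 0 := by
    refine hinj _ (hinj _ ?_)
    have h1 := hcent x
    have h3 := hcent (c * x * c)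
    have : ∀ y : A, y = c * x * c - c * c * x → c * (c * y + y * c) + (c * y + y * c) * c =
      c * c * y + y * (c * c) + 2 * (c * y * c) := by intros; noncomm_ring
    rw [this _ rfl]
    have e1 : c * (c * x * c - c * c * x) * c = c * c * (x * (c * c)) - c * c * (c * x * c) := by
      noncomm_ring
    have e2 := hcent (c * x * c - c * c * x)
    rw [← e2, e1, ← h1]
    noncomm_ring
  have hz : c * (x * c - c * x) = 0 := by
    rw [← key]; noncomm_ring
  have hz' : (x * c - c * x) * c = 0 := by
    refine hinj _ ?_
    have h1 := hcent (x * c - c * x)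
    rw [← mul_assoc, hz, zero_mul, zero_add, mul_assoc, ← h1, mul_assoc, hz, mul_zero]
  have := hinj (x * c - c * x) (by rw [hz, hz', add_zero])
  exact (sub_eq_zero.1 this).symm

end Jordan

namespace Matrix

variable {L n : Type*} [Field L] [Fintype n] [DecidableEq n]

lemma trace_eq_one_of_sandwich {f : Matrix n n L} (hf : f * f = f) (h0 : f ≠ 0)
    (h : ∀ x, ∃ a : L, f * x * f = a • f) : f.trace = 1 := by
  choose a ha using h
  have key : ∀ p i j q, f p i * f j q = a (single i j 1) * f p q := by
    intro p i j q
    have := congrFun (congrFun (ha (single i j 1)) p) q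
    rw [smul_apply, smul_eq_mul] at this
    rw [← this, mul_assoc, mul_apply, Finset.sum_eq_single i]
    · simp
    · intro b _ hb
      simp [single_mul_apply_of_ne _ _ _ _ _ hb]
    · simp
  obtain ⟨p, q, hpq⟩ : ∃ p q, f p q ≠ 0 := by
    by_contra! hc
    exact h0 (by ext i j; exact hc i j)
  have h1 : a (single q p 1) = f p q := by
    have := key p q p q
    exact (mul_right_cancel₀ hpq this).symm
  have h3 : ∀ i, f i i * f p q = f p i * f i q := by
    intro i
    rw [← h1, mul_comm, ← key i q p i, mul_comm]
  have h4 : f p q = f.trace * f p q := by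
    conv_lhs => rw [← hf, mul_apply]
    rw [trace, Finset.sum_mul]
    exact Finset.sum_congr rfl fun i _ => (h3 i).symm
  exact (mul_right_cancel₀ hpq (by rw [one_mul, ← h4])).symm

lemma span_idempotent_eq_top : Submodule.span L {e : Matrix n n L | e * e = e} = ⊤ := by
  have hd : ∀ i : n, single i i (1 : L) ∈ Submodule.span L {e : Matrix n n L | e * e = e} :=
    fun i => Submodule.subset_span (by simp)
  have hs : ∀ i j : n, single i j (1 : L) ∈ Submodule.span L {e : Matrix n n L | e * e = e} := by
    intro i j
    by_cases hij : i = j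
    · exact hij ▸ hd i
    · have : single i i (1 : L) + single i j 1 ∈
          Submodule.span L {e : Matrix n n L | e * e = e} :=
        Submodule.subset_span (by simp [mul_add, add_mul, Ne.symm hij])
      simpa using Submodule.sub_mem _ this (hd i)
  rw [eq_top_iff]
  intro x _
  rw [matrix_eq_sum_single x]
  refine Submodule.sum_mem _ fun i _ => Submodule.sum_mem _ fun j _ => ?_
  have : single i j (x i j) = x i j • single i j (1 : L) := by simp [smul_single]
  rw [this]
  exact Submodule.smul_mem _ _ (hs i j)

lemma trace_jordan_map (h2 : (2 : L) ≠ 0) {J : Matrix n n L →ₗ[L] Matrix n n L}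
    (hs : Function.Surjective J) (hJ : ∀ x y, J (x * y + y * x) = J x * J y + J y * J x)
    (x : Matrix n n L) : (J x).trace = x.trace := by
  have hi : Function.Injective J := LinearMap.injective_iff_surjective.2 hs
  have hb : ∀ i j : n, (J (single i j 1)).trace = (single i j (1 : L)).trace := by
    intro i j
    by_cases hij : i = j
    · subst hij
      rw [trace_single_eq_same]
      refine trace_eq_one_of_sandwich ?_ ?_ ?_
      · rw [← jordan_map_sq h2 hJ]; simp
      · rw [Ne, map_eq_zero_iff J hi]
        intro h
        simpa using congrFun (congrFun h i) i
      · intro y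
        obtain ⟨z, rfl⟩ := hs y
        refine ⟨z i i, ?_⟩
        rw [← jordan_map_sandwich h2 hJ, ← map_smul]
        simp [smul_single]
    · rw [trace_single_eq_of_ne _ _ _ hij]
      refine (isNilpotent_trace_of_isNilpotent ⟨2, ?_⟩).eq_zero
      rw [pow_two, ← jordan_map_sq h2 hJ]
      simp [Ne.symm hij]
  have : traceLinearMap n L L ∘ₗ J = traceLinearMap n L L :=
    (Matrix.stdBasis L n n).ext fun ⟨i, j⟩ => by
      simpa [stdBasis_eq_single] using hb i j
  exact LinearMap.congr_fun this x

lemma functional_eq_smul_trace [Nonempty n] {g : Matrix n n L →ₗ[L] L}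
    (hg : ∀ x y, g (x * y) = g (y * x)) : ∃ a : L, ∀ x, g x = a * x.trace := by
  obtain ⟨k⟩ := ‹Nonempty n›
  refine ⟨g (single k k 1), fun x => ?_⟩
  have : g = g (single k k 1) • traceLinearMap n L L :=
    (Matrix.stdBasis L n n).ext fun ⟨i, j⟩ => by
      by_cases hij : i = j
      · subst hij
        have := hg (single i k 1) (single k i 1)
        simpa [stdBasis_eq_single] using this
      · have := hg (single i i 1) (single i j 1)
        simpa [stdBasis_eq_single, hij, Ne.symm hij] using this
  conv_lhs => rw [this]
  simp

/-- A linear map of matrices preserving the polarised form `tr x ^ 3` sends `1` to a central cube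
root of unity. -/
lemma central_and_cube_of_trace_form [Nonempty n] (h2 : (2 : L) ≠ 0)
    {T : Matrix n n L →ₗ[L] Matrix n n L}
    (hT : ∀ x y z, ((T x * T y + T y * T x) * T z).trace = ((x * y + y * x) * z).trace) :
    (∀ x, T 1 * x = x * T 1) ∧ T 1 ^ 3 = 1 := by
  have hi : Function.Injective T := by
    rw [injective_iff_map_eq_zero]
    intro x hx
    rw [ext_iff_trace_mul_right]
    intro z
    have := hT x 1 z
    rw [hx] at this
    simp only [zero_mul, mul_zero, add_zero, trace_zero, mul_one, one_mul, add_mul,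
      trace_add] at this
    rw [← two_mul, eq_comm, mul_eq_zero] at this
    simpa using this.resolve_left h2
  have hs : Function.Surjective T := LinearMap.injective_iff_surjective.1 hi
  have h1 : ∀ x y, 2 * (T x * T y + T y * T x) =
      T (x * y + y * x) * T 1 + T 1 * T (x * y + y * x) := by
    intro x y
    rw [ext_iff_trace_mul_right]
    intro z
    obtain ⟨z, rfl⟩ := hs z
    rw [hT, two_mul, add_mul, trace_add, hT]
    simp only [mul_one, one_mul, add_mul, trace_add]
  have hc := map_one_commute_of_span_idempotent h2 span_idempotent_eq_top hs h1
  refine ⟨hc, ?_⟩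
  obtain ⟨a, ha⟩ : ∃ a : L, T 1 = a • (1 : Matrix n n L) := by
    obtain ⟨a, ha⟩ := mem_range_scalar_of_commute_single (M := T 1)
      (fun i j _ => (hc _).symm)
    exact ⟨a, by rw [← ha, smul_one_eq_diagonal]; rfl⟩
  have ha0 : a ≠ 0 := by
    rintro rfl
    rw [zero_smul] at ha
    exact one_ne_zero (hi (ha.trans (map_zero T).symm))
  have hJ : ∀ x y, (a⁻¹ • T) (x * y + y * x) =
      (a⁻¹ • T) x * (a⁻¹ • T) y + (a⁻¹ • T) y * (a⁻¹ • T) x := by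
    intro x y
    have := h1 x y
    rw [ha, mul_smul_comm, smul_mul_assoc, mul_one, one_mul, ← smul_add, ← two_mul,
      ← mul_smul_comm] at this
    have := eq_of_two_mul_eq h2 this
    simp only [LinearMap.smul_apply, smul_mul_assoc, mul_smul_comm, ← smul_add]
    rw [this, inv_smul_smul₀ ha0]
  have hJs : Function.Surjective (a⁻¹ • T) := fun y => by
    obtain ⟨x, hx⟩ := hs (a • y)
    exact ⟨x, by rw [LinearMap.smul_apply, hx, inv_smul_smul₀ ha0]⟩
  obtain ⟨k⟩ := ‹Nonempty n›
  have h5 := trace_jordan_map h2 hJs hJ (single k k 1)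
  have h6 := hT 1 1 (single k k 1)
  rw [LinearMap.smul_apply, trace_smul, trace_single_eq_same, smul_eq_mul,
    inv_mul_eq_one₀ ha0] at h5
  simp only [ha, mul_one, ← two_smul L, smul_mul_assoc, one_mul, trace_smul,
    trace_single_eq_same, ← h5, smul_eq_mul] at h6
  have h7 : a ^ 3 = 1 := by
    refine mul_left_cancel₀ h2 ?_
    linear_combination h6
  rw [ha, smul_pow, h7, one_pow, one_smul]

end Matrix

section CentralSimple

open TensorProduct

variable {K B : Type*} [Field K] [Ring B] [Algebra K B]

lemma exists_sum_of_mulLeftRight (t : B ⊗[K] Bᵐᵒᵖ) : ∃ (n : ℕ) (a b : Fin n → B),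
    ∀ x, AlgHom.mulLeftRight K B t x = ∑ i, a i * x * b i := by
  induction t using TensorProduct.induction_on with
  | zero => exact ⟨0, 0, 0, fun x => by simp⟩
  | tmul a b => exact ⟨1, fun _ => a, fun _ => b.unop, fun x => by simp⟩
  | add s t hs ht =>
    obtain ⟨m, a, b, hab⟩ := hs
    obtain ⟨n, c, d, hcd⟩ := ht
    exact ⟨m + n, Fin.append a c, Fin.append b d, fun x => by
      simp [Fin.sum_univ_add, hab, hcd]⟩

variable (K B) in
lemma isSimpleModule_mulLeftRight_range [IsSimpleRing B] :
    IsSimpleModule (AlgHom.mulLeftRight K B).range B := by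
  have hR : ∀ (a b x : B) (N : Submodule (AlgHom.mulLeftRight K B).range B), x ∈ N →
      a * x * b ∈ N := by
    intro a b x N hx
    have := N.smul_mem ⟨AlgHom.mulLeftRight K B (a ⊗ₜ MulOpposite.op b), ⟨_, rfl⟩⟩ hx
    simpa [Subalgebra.smul_def] using this
  rw [isSimpleModule_iff]
  refine { exists_pair_ne := ⟨⊥, ⊤, bot_ne_top⟩, eq_bot_or_eq_top := fun N => ?_ }
  let I : TwoSidedIdeal B := TwoSidedIdeal.mk' N N.zero_mem N.add_mem
    (fun {x} hx => by simpa using hR (-1) 1 x N hx)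
    (fun {a x} hx => by simpa using hR a 1 x N hx) (fun {x b} hx => by simpa using hR 1 b x N hx)
  have hI : ∀ x, x ∈ I ↔ x ∈ N := fun x => TwoSidedIdeal.mem_mk' ..
  by_cases h : N = ⊥
  · exact Or.inl h
  · right
    obtain ⟨x, hx, hx0⟩ := N.exists_mem_ne_zero_of_ne_bot h
    have h1 := (hI 1).1 (IsSimpleRing.one_mem_of_ne_zero_mem I hx0 ((hI x).2 hx))
    exact eq_top_iff.2 fun y _ => by simpa using hR y 1 1 N h1

/-- Every linear endomorphism of a central simple algebra lies in its multiplication algebra. -/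
lemma exists_sum_mul_mul_of_isCentral [Algebra.IsCentral K B] [IsSimpleRing B]
    [FiniteDimensional K B] (f : B →ₗ[K] B) :
    ∃ (n : ℕ) (a b : Fin n → B), ∀ x, f x = ∑ i, a i * x * b i := by
  have := isSimpleModule_mulLeftRight_range K B
  let R := (AlgHom.mulLeftRight K B).range
  have hg : ∀ g : Module.End R B, ∃ k : K, ∀ x, g x = k • x := by
    intro g
    have hab : ∀ a b x : B, g (a * x * b) = a * g x * b := by
      intro a b x
      have := g.map_smul (⟨AlgHom.mulLeftRight K B (a ⊗ₜ MulOpposite.op b), ⟨_, rfl⟩⟩ : R) x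
      simpa [Subalgebra.smul_def] using this
    have h1 : ∀ x, g x = x * g 1 := fun x => by simpa using hab x 1 1
    have h2 : ∀ x, g x = g 1 * x := fun x => by simpa using hab 1 x 1
    obtain ⟨k, hk⟩ := (Algebra.IsCentral.mem_center_iff K (D := B)).1
      (Subalgebra.mem_center_iff.2 fun x => (h1 x).symm.trans (h2 x))
    exact ⟨k, fun x => by rw [h2, hk, Algebra.smul_def]⟩
  let f' : Module.End (Module.End R B) B :=
    { toFun := f
      map_add' := f.map_add
      map_smul' := fun g x => by
        obtain ⟨k, hk⟩ := hg g
        simp [hk] }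
  obtain ⟨s, hs⟩ := Module.Finite.fg_top (R := K) (M := B)
  obtain ⟨⟨_, t, rfl⟩, hr⟩ := jacobson_density (R := R) f' s
  obtain ⟨n, a, b, hab⟩ := exists_sum_of_mulLeftRight t
  refine ⟨n, a, b, fun x => ?_⟩
  rw [← hab]
  exact LinearMap.congr_fun (LinearMap.ext_on hs
    (g := (AlgHom.mulLeftRight K B t : B →ₗ[K] B)) fun m hm => hr m hm) x

/-- Scalar extensions of central simple algebras are simple. -/
lemma isSimpleRing_baseChange [Algebra.IsCentral K B] [IsSimpleRing B]
    [FiniteDimensional K B] (L : Type*) [Field L] [Algebra K L] : IsSimpleRing (L ⊗[K] B) := by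
  let v := Module.finBasis K B
  let w := v.baseChange L
  have : Nontrivial (L ⊗[K] B) := by
    refine Module.nontrivial_of_finrank_pos (R := L) ?_
    rw [Module.finrank_baseChange]
    exact Module.finrank_pos
  refine IsSimpleRing.of_eq_bot_or_eq_top fun I => ?_
  by_cases h : I = ⊥
  · exact Or.inl h
  right
  obtain ⟨x, hx, hx0⟩ : ∃ x ∈ I, x ≠ 0 := by
    by_contra! hc
    exact h (eq_bot_iff.2 fun x hx => (TwoSidedIdeal.mem_bot _).2 (hc x hx))
  obtain ⟨i, hi⟩ : ∃ i, w.repr x i ≠ 0 := by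
    by_contra! hc
    exact hx0 (w.repr.map_eq_zero_iff.1 (Finsupp.ext hc))
  obtain ⟨n, a, b, hab⟩ := exists_sum_mul_mul_of_isCentral ((v.coord i).smulRight (1 : B))
  have key : ∑ j, ((1 : L) ⊗ₜ[K] a j) * x * ((1 : L) ⊗ₜ[K] b j) = w.repr x i ⊗ₜ[K] (1 : B) := by
    conv_lhs => rw [← w.sum_repr x]
    simp only [Finset.mul_sum, Finset.sum_mul, mul_smul_comm, smul_mul_assoc]
    rw [Finset.sum_comm]
    simp only [← Finset.smul_sum]
    simp only [w, Module.Basis.baseChange_apply, Algebra.TensorProduct.tmul_mul_tmul, one_mul,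
      ← TensorProduct.tmul_sum, ← hab]
    rw [Finset.sum_eq_single i]
    · simp [TensorProduct.smul_tmul']
    · intro k _ hk
      simp [hk]
    · simp
  have hmem : w.repr x i ⊗ₜ[K] (1 : B) ∈ I := by
    rw [← key]
    exact sum_mem fun j _ => I.mul_mem_right _ _ (I.mul_mem_left _ _ hx)
  have h1 : (1 : L ⊗[K] B) ∈ I := by
    have := I.mul_mem_left ((w.repr x i)⁻¹ ⊗ₜ[K] (1 : B)) _ hmem
    rwa [Algebra.TensorProduct.tmul_mul_tmul, inv_mul_cancel₀ hi, one_mul] at this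
  exact (TwoSidedIdeal.one_mem_iff I).1 h1

universe u v in
/-- A finite-dimensional central simple algebra embeds in a matrix algebra over a field in such a
way that linear maps extend uniquely. -/
lemma exists_splitting (K : Type u) (B : Type v) [Field K] [Ring B] [Algebra K B]
    [Algebra.IsCentral K B] [IsSimpleRing B] [FiniteDimensional K B] :
    ∃ (L : Type u) (_ : Field L) (_ : Algebra K L) (n : ℕ) (_ : NeZero n)
      (φ : B →ₐ[K] Matrix (Fin n) (Fin n) L),
      Function.Injective φ ∧ Submodule.span L (Set.range φ) = ⊤ ∧
      (∀ f : B →ₗ[K] B, ∃ g : Matrix (Fin n) (Fin n) L →ₗ[L] Matrix (Fin n) (Fin n) L,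
        ∀ x, g (φ x) = φ (f x)) ∧
      (∀ f : B →ₗ[K] K, ∃ g : Matrix (Fin n) (Fin n) L →ₗ[L] L,
        ∀ x, g (φ x) = algebraMap K L (f x)) := by
  let L := AlgebraicClosure K
  have := isSimpleRing_baseChange (K := K) (B := B) L
  obtain ⟨n, hn, ⟨e⟩⟩ := IsSimpleRing.exists_algEquiv_matrix_of_isAlgClosed L (L ⊗[K] B)
  let φ : B →ₐ[K] Matrix (Fin n) (Fin n) L :=
    ((e : L ⊗[K] B →ₐ[L] _).restrictScalars K).comp Algebra.TensorProduct.includeRight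
  have hφ : ∀ x, φ x = e ((1 : L) ⊗ₜ x) := fun x => rfl
  refine ⟨L, inferInstance, inferInstance, n, hn, φ, ?_, ?_, ?_, ?_⟩
  · exact φ.toRingHom.injective
  · rw [eq_top_iff]
    rintro y -
    obtain ⟨x, rfl⟩ := e.surjective y
    induction x using TensorProduct.induction_on with
    | zero => simp
    | tmul l b =>
      have : e (l ⊗ₜ b) = l • φ b := by
        rw [hφ, ← map_smul, TensorProduct.smul_tmul', smul_eq_mul, mul_one]
      rw [this]
      exact Submodule.smul_mem _ _ (Submodule.subset_span ⟨b, rfl⟩)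
    | add x y hx hy =>
      rw [map_add]
      exact Submodule.add_mem _ hx hy
  · intro f
    refine ⟨e.toLinearMap ∘ₗ f.baseChange L ∘ₗ e.symm.toLinearMap, fun x => ?_⟩
    simp [hφ]
  · intro f
    refine ⟨(TensorProduct.AlgebraTensorModule.rid K L L).toLinearMap ∘ₗ f.baseChange L ∘ₗ
      e.symm.toLinearMap, fun x => ?_⟩
    simp [hφ, Algebra.algebraMap_eq_smul_one]

end CentralSimple

section Commutators

variable {F A : Type*} [Field F] [Ring A] [Algebra F A]

lemma commutator_mem_commutatorSpan (x y : A) : x * y - y * x ∈ commutatorSpan F A :=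
  Submodule.subset_span ⟨x, y, rfl⟩

lemma map_mem_commutatorSpan {B : Type*} [Ring B] [Algebra F B] (f : A →ₗ[F] B)
    (hf : ∀ x y, f (x * y) = f x * f y) {x : A} (hx : x ∈ commutatorSpan F A) :
    f x ∈ commutatorSpan F B := by
  have : commutatorSpan F A ≤ (commutatorSpan F B).comap f := by
    refine Submodule.span_le.2 ?_
    rintro _ ⟨u, v, rfl⟩
    rw [SetLike.mem_coe, Submodule.mem_comap, map_sub, hf, hf]
    exact commutator_mem_commutatorSpan _ _
  exact this hx

lemma center_mul_mem_commutatorSpan {z x : A} (hz : ∀ y, z * y = y * z)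
    (hx : x ∈ commutatorSpan F A) : z * x ∈ commutatorSpan F A := by
  have : commutatorSpan F A ≤ (commutatorSpan F A).comap (LinearMap.mulLeft F z) := by
    refine Submodule.span_le.2 ?_
    rintro _ ⟨u, v, rfl⟩
    rw [SetLike.mem_coe, Submodule.mem_comap, LinearMap.mulLeft_apply]
    have : z * (u * v - v * u) = (z * u) * v - v * (z * u) := by
      rw [mul_sub, ← mul_assoc, ← mul_assoc, hz v, mul_assoc v]
    rw [this]
    exact commutator_mem_commutatorSpan _ _
  exact this hx

/-- Polarisation of the cube modulo commutators. -/
lemma polarized_of_cube_mem_commutatorSpan (h3 : (3 : F) ≠ 0)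
    {T : A →ₗ[F] A} (hT : ∀ x, T x ^ 3 - x ^ 3 ∈ commutatorSpan F A) (x y z : A) :
    (T x * T y + T y * T x) * T z - (x * y + y * x) * z ∈ commutatorSpan F A := by
  have hpol : ∀ a b c : A, (3 : F) • ((a * b + b * a) * c) -
      ((a + b + c) ^ 3 - (a + b) ^ 3 - (a + c) ^ 3 - (b + c) ^ 3 + a ^ 3 + b ^ 3 + c ^ 3) ∈
      commutatorSpan F A := by
    intro a b c
    have : (3 : F) • ((a * b + b * a) * c) -
      ((a + b + c) ^ 3 - (a + b) ^ 3 - (a + c) ^ 3 - (b + c) ^ 3 + a ^ 3 + b ^ 3 + c ^ 3) =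
      ((a * b) * c - c * (a * b)) + ((b * a) * c - c * (b * a)) +
      (a * (b * c) - (b * c) * a) + (b * (a * c) - (a * c) * b) := by
      rw [ofNat_smul_eq_nsmul]
      noncomm_ring
    rw [this]
    exact add_mem (add_mem (add_mem (commutator_mem_commutatorSpan _ _)
      (commutator_mem_commutatorSpan _ _)) (commutator_mem_commutatorSpan _ _))
      (commutator_mem_commutatorSpan _ _)
  have hsum := add_mem (add_mem (add_mem (sub_mem (sub_mem (sub_mem (hT (x + y + z))
    (hT (x + y))) (hT (x + z))) (hT (y + z))) (hT x)) (hT y)) (hT z)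
  have h := add_mem (sub_mem (hpol (T x) (T y) (T z)) (hpol x y z)) hsum
  refine (Submodule.smul_mem_iff _ h3).1 ?_
  convert h using 1
  simp only [map_add, smul_sub]
  abel

end Commutators

section Simple

variable {K B : Type*} [Field K] [Ring B] [Algebra K B]

lemma trace_eq_zero_of_mem_commutatorSpan {L n : Type*} [Field L] [Algebra K L] [Fintype n]
    [DecidableEq n] (φ : B →ₐ[K] Matrix n n L) {x : B} (hx : x ∈ commutatorSpan K B) :
    (φ x).trace = 0 := by
  induction hx using Submodule.span_induction with
  | mem x hx =>
    obtain ⟨u, v, rfl⟩ := hx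
    rw [map_sub, map_mul, map_mul, Matrix.trace_sub, Matrix.trace_mul_comm, sub_self]
  | zero => simp
  | add x y _ _ hx hy => rw [map_add, Matrix.trace_add, hx, hy, add_zero]
  | smul a x _ hx => rw [map_smul, Matrix.trace_smul, hx, smul_zero]

lemma bilinear_ext_of_span {L M N : Type*} [Field L] [Ring M] [Algebra L M]
    [AddCommGroup N] [Module L N] {S : Set M} (hS : Submodule.span L S = ⊤)
    {f g : M →ₗ[L] M →ₗ[L] N} (h : ∀ x ∈ S, ∀ y ∈ S, f x y = g x y) (x y : M) :
    f x y = g x y := by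
  have : f = g := LinearMap.ext_on hS fun x hx => LinearMap.ext_on hS fun y hy => h x hx y hy
  rw [this]

lemma mem_commutatorSpan_of_trace {L n : Type*} [Field L] [Algebra K L] [Fintype n]
    [DecidableEq n] [Nonempty n] (φ : B →ₐ[K] Matrix n n L)
    (hspan : Submodule.span L (Set.range φ) = ⊤)
    (hext : ∀ f : B →ₗ[K] K, ∃ g : Matrix n n L →ₗ[L] L, ∀ x, g (φ x) = algebraMap K L (f x))
    {x : B} (hx : (φ x).trace = 0) : x ∈ commutatorSpan K B := by
  by_contra hxC
  obtain ⟨f, hfx, hf⟩ := Submodule.exists_le_ker_of_notMem hxC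
  obtain ⟨g, hg⟩ := hext f
  have hcomm : ∀ X Y, g (X * Y) = g (Y * X) := by
    refine bilinear_ext_of_span hspan (f := (LinearMap.mul L _).compr₂ g)
      (g := (LinearMap.mul L _).flip.compr₂ g) ?_
    rintro _ ⟨u, rfl⟩ _ ⟨v, rfl⟩
    have : f (u * v - v * u) = 0 := hf (commutator_mem_commutatorSpan u v)
    rw [map_sub, sub_eq_zero] at this
    simp only [LinearMap.compr₂_apply, LinearMap.mul_apply', LinearMap.flip_apply]
    rw [← map_mul, ← map_mul, hg, hg, this]
  obtain ⟨a, ha⟩ := Matrix.functional_eq_smul_trace hcomm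
  have := hg x
  rw [ha, hx, mul_zero, eq_comm, map_eq_zero] at this
  exact hfx this

variable [Algebra.IsCentral K B] [IsSimpleRing B] [FiniteDimensional K B]

lemma eq_zero_of_mul_mem_commutatorSpan {x : B} (hx : ∀ y, x * y ∈ commutatorSpan K B) :
    x = 0 := by
  obtain ⟨L, _, _, n, _, φ, hinj, hspan, -, -⟩ := exists_splitting K B
  have h0 : ∀ Y, (φ x * Y).trace = 0 := by
    intro Y
    have : Matrix.traceLinearMap (Fin n) L L ∘ₗ LinearMap.mulLeft L (φ x) = 0 := by
      refine LinearMap.ext_on hspan ?_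
      rintro _ ⟨y, rfl⟩
      simpa using trace_eq_zero_of_mem_commutatorSpan φ (hx y)
    exact LinearMap.congr_fun this Y
  rw [← map_eq_zero_iff φ hinj, Matrix.ext_iff_trace_mul_right]
  simpa using h0

lemma map_one_central_and_cube (h2 : (2 : K) ≠ 0) {T : B →ₗ[K] B}
    (hT : ∀ x y z, (T x * T y + T y * T x) * T z - (x * y + y * x) * z ∈ commutatorSpan K B) :
    (∀ x, T 1 * x = x * T 1) ∧ T 1 ^ 3 = 1 := by
  obtain ⟨L, _, _, n, _, φ, hinj, hspan, hext, -⟩ := exists_splitting K B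
  have h2L : (2 : L) ≠ 0 := by
    simpa only [map_ofNat] using (map_ne_zero (algebraMap K L)).2 h2
  obtain ⟨S, hS⟩ := hext T
  have hform : ∀ X Y Z, ((S X * S Y + S Y * S X) * S Z).trace = ((X * Y + Y * X) * Z).trace := by
    have hind : ∀ P : Matrix (Fin n) (Fin n) L → Prop, (∀ x, P (φ x)) → P 0 →
        (∀ X Y, P X → P Y → P (X + Y)) → (∀ (a : L) X, P X → P (a • X)) → ∀ X, P X := by
      intro P h1 h0 ha hs X
      have hX : X ∈ Submodule.span L (Set.range φ) := hspan ▸ Submodule.mem_top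
      induction hX using Submodule.span_induction with
      | mem X hX => obtain ⟨x, rfl⟩ := hX; exact h1 x
      | zero => exact h0
      | add X Y _ _ hX hY => exact ha X Y hX hY
      | smul a X _ hX => exact hs a X hX
    refine hind _ (fun x => hind _ (fun y => hind _ (fun z => ?_) ?_ ?_ ?_) ?_ ?_ ?_) ?_ ?_ ?_
    · have := trace_eq_zero_of_mem_commutatorSpan φ (hT x y z)
      simp only [map_sub, map_mul, map_add, Matrix.trace_sub] at this
      rw [hS, hS, hS]
      exact sub_eq_zero.1 this
    all_goals first
      | simp; done
      | intro X Y hX hY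
        simp only [map_add, mul_add, add_mul, Matrix.trace_add] at hX hY ⊢
        try intro Z
        try intro Z'
        try specialize hX Z
        try specialize hY Z
        try specialize hX Z'
        try specialize hY Z'
        linear_combination hX + hY
      | intro a X hX
        simp only [map_smul, smul_mul_assoc, mul_smul_comm, ← smul_add, Matrix.trace_smul]
        try intro Z
        try intro Z'
        simp only [hX]
  obtain ⟨hc, h1⟩ := Matrix.central_and_cube_of_trace_form h2L hform
  rw [← map_one φ, hS] at hc h1
  refine ⟨fun x => hinj ?_, hinj ?_⟩
  · rw [map_mul, map_mul, hc]
  · rw [map_pow, h1]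

lemma jordan_sub_self_mem_commutatorSpan (h2 : (2 : K) ≠ 0) {J : B →ₗ[K] B}
    (hs : Function.Surjective J)
    (hJ : ∀ x y, J (x * y + y * x) = J x * J y + J y * J x) (x : B) :
    J x - x ∈ commutatorSpan K B := by
  obtain ⟨L, _, _, n, _, φ, hinj, hspan, hext, hext'⟩ := exists_splitting K B
  have h2L : (2 : L) ≠ 0 := by
    simpa only [map_ofNat] using (map_ne_zero (algebraMap K L)).2 h2
  obtain ⟨S, hS⟩ := hext J
  have hSs : Function.Surjective S := by
    rw [← LinearMap.range_eq_top, eq_top_iff, ← hspan, Submodule.span_le]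
    rintro _ ⟨y, rfl⟩
    obtain ⟨x, rfl⟩ := hs y
    exact ⟨φ x, hS x⟩
  have hSJ : ∀ X Y, S (X * Y + Y * X) = S X * S Y + S Y * S X := by
    let μ := LinearMap.mul L (Matrix (Fin n) (Fin n) L)
    refine bilinear_ext_of_span hspan (f := (μ + μ.flip).compr₂ S)
      (g := (μ + μ.flip).compl₁₂ S S) ?_
    rintro _ ⟨u, rfl⟩ _ ⟨v, rfl⟩
    have := congrArg φ (hJ u v)
    rw [← hS] at this
    simpa [μ, hS] using this
  refine mem_commutatorSpan_of_trace φ hspan hext' ?_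
  rw [map_sub, Matrix.trace_sub, ← hS, Matrix.trace_jordan_map h2L hSs hSJ, sub_self]

end Simple

section Center

lemma isField_subalgebra_center (F B : Type*) [Field F] [Ring B] [Algebra F B] [IsSimpleRing B] :
    IsField (Subalgebra.center F B) :=
  IsSimpleRing.isField_center B

universe u v in
/-- A finite-dimensional simple algebra is central simple over a field with the same commutator
span, whose linear endomorphisms are the endomorphisms commuting with central multiplications. -/
lemma exists_center_field (F : Type u) (B : Type v) [Field F] [Ring B] [Algebra F B]
    [FiniteDimensional F B] [IsSimpleRing B] :
    ∃ (K : Type v) (_ : Field K) (_ : Algebra K B), Algebra.IsCentral K B ∧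
      FiniteDimensional K B ∧ (∀ x, x ∈ commutatorSpan K B ↔ x ∈ commutatorSpan F B) ∧
      (∀ f : B →ₗ[F] B, (∀ z, (∀ y, z * y = y * z) → ∀ x, f (z * x) = z * f x) →
        ∃ g : B →ₗ[K] B, ∀ x, g x = f x) ∧ ((2 : F) ≠ 0 → (2 : K) ≠ 0) := by
  let K := Subalgebra.center F B
  have hK : ∀ (k : K) (y : B), (k : B) * y = y * k := fun k y =>
    (Subalgebra.mem_center_iff.1 k.2 y).symm
  let fieldK : Field K := (isField_subalgebra_center F B).toField
  let algKB : Algebra K B :=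
    RingHom.toAlgebra' (⟨⟨⟨Subtype.val, rfl⟩, fun _ _ => rfl⟩, rfl, fun _ _ => rfl⟩ : K →+* B) hK
  let algFK : Algebra F K :=
    RingHom.toAlgebra (⟨⟨⟨fun a => ⟨algebraMap F B a, Subalgebra.algebraMap_mem _ a⟩,
      Subtype.ext (map_one _)⟩, fun a b => Subtype.ext (map_mul _ a b)⟩,
      Subtype.ext (map_zero _), fun a b => Subtype.ext (map_add _ a b)⟩ : F →+* K)
  have tower : IsScalarTower F K B := IsScalarTower.of_algebraMap_eq fun _ => rfl
  refine ⟨K, fieldK, algKB, ⟨?_⟩, ?_, fun x => ⟨fun hx => ?_, fun hx => ?_⟩, ?_, ?_⟩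
  · intro x hx
    exact ⟨⟨x, Subalgebra.mem_center_iff.2 (Subalgebra.mem_center_iff.1 hx)⟩, rfl⟩
  · exact Module.Finite.of_restrictScalars_finite F K B
  · induction hx using Submodule.span_induction with
    | mem x hx => exact Submodule.subset_span hx
    | zero => exact zero_mem _
    | add x y _ _ hx hy => exact add_mem hx hy
    | smul a x _ hx => exact center_mul_mem_commutatorSpan (hK a) hx
  · exact Submodule.span_le_restrictScalars F K _ hx
  · exact fun f hf => ⟨{ f with map_smul' := fun k x => hf k (hK k) x }, fun x => rfl⟩
  · intro h2
    simpa only [map_ofNat] using (map_ne_zero (algebraMap F K)).2 h2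

variable {F B : Type*} [Field F] [Ring B] [Algebra F B] [FiniteDimensional F B] [IsSimpleRing B]

lemma IsSimpleRing.eq_zero_of_mul_mem_commutatorSpan {x : B}
    (hx : ∀ y, x * y ∈ commutatorSpan F B) : x = 0 := by
  obtain ⟨K, _, _, _, _, hK, -, -⟩ := exists_center_field F B
  exact _root_.eq_zero_of_mul_mem_commutatorSpan (K := K) fun y => (hK _).2 (hx y)

lemma IsSimpleRing.map_one_central_and_cube (h2 : (2 : F) ≠ 0) {T : B →ₗ[F] B}
    (hZ : ∀ z, (∀ y, z * y = y * z) → ∀ x, T (z * x) = z * T x)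
    (hT : ∀ x y z, (T x * T y + T y * T x) * T z - (x * y + y * x) * z ∈ commutatorSpan F B) :
    (∀ x, T 1 * x = x * T 1) ∧ T 1 ^ 3 = 1 := by
  obtain ⟨K, _, _, _, _, hK, hf, h2K⟩ := exists_center_field F B
  obtain ⟨S, hS⟩ := hf T hZ
  simpa only [hS] using _root_.map_one_central_and_cube (h2K h2) (T := S) fun x y z => by
    simpa only [hS, hK] using hT x y z

lemma IsSimpleRing.jordan_sub_self_mem_commutatorSpan (h2 : (2 : F) ≠ 0) {J : B →ₗ[F] B}
    (hZ : ∀ z, (∀ y, z * y = y * z) → ∀ x, J (z * x) = z * J x)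
    (hs : Function.Surjective J)
    (hJ : ∀ x y, J (x * y + y * x) = J x * J y + J y * J x) (x : B) :
    J x - x ∈ commutatorSpan F B := by
  obtain ⟨K, _, _, _, _, hK, hf, h2K⟩ := exists_center_field F B
  obtain ⟨S, hS⟩ := hf J hZ
  have := _root_.jordan_sub_self_mem_commutatorSpan (h2K h2) (J := S)
    (fun y => by simpa only [hS] using hs y) (fun x y => by simpa only [hS] using hJ x y) x
  simpa only [hS, hK] using this

lemma IsSimpleRing.exists_sum_mul_mul_s10 {f : B →ₗ[F] B}
    (hZ : ∀ z, (∀ y, z * y = y * z) → ∀ x, f (z * x) = z * f x) :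
    ∃ (n : ℕ) (a b : Fin n → B), ∀ x, f x = ∑ i, a i * x * b i := by
  obtain ⟨K, _, _, _, _, -, hf, -⟩ := exists_center_field F B
  obtain ⟨g, hg⟩ := hf f hZ
  simpa only [hg] using exists_sum_mul_mul_of_isCentral g

end Center

/-- A decomposition of an algebra as a finite product of algebras, given by the projections and the
inclusions of the factors. -/
structure FactorDecomposition (F A : Type*) [Field F] [Ring A] [Algebra F A] {m : ℕ}
    (B : Fin m → Type*) [∀ i, Ring (B i)] [∀ i, Algebra F (B i)] where
  /-- The projection to a factor. -/
  proj : ∀ i, A →ₐ[F] B i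
  /-- The inclusion of a factor. -/
  incl : ∀ i, B i →ₗ[F] A
  proj_incl : ∀ i b, proj i (incl i b) = b
  incl_mul : ∀ i b x, incl i b * x = incl i (b * proj i x)
  mul_incl : ∀ i b x, x * incl i b = incl i (proj i x * b)
  sum_incl_proj : ∀ x, ∑ i, incl i (proj i x) = x

namespace FactorDecomposition

variable {F A : Type*} [Field F] [Ring A] [Algebra F A] {m : ℕ}
  {B : Fin m → Type*} [∀ i, Ring (B i)] [∀ i, Algebra F (B i)]

/-- The decomposition of an algebra isomorphic to a product. -/
def ofAlgEquiv (e : A ≃ₐ[F] Π i, B i) : FactorDecomposition F A B where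
  proj i := (Pi.evalAlgHom F B i).comp (e : A →ₐ[F] Π i, B i)
  incl i := e.symm.toLinearMap ∘ₗ LinearMap.single F B i
  proj_incl i b := by simp
  incl_mul i b x := by
    apply e.injective
    ext j
    by_cases h : j = i
    · subst h; simp
    · simp [h]
  mul_incl i b x := by
    apply e.injective
    ext j
    by_cases h : j = i
    · subst h; simp
    · simp [h]
  sum_incl_proj x := by
    apply e.injective
    simp [map_sum, LinearMap.sum_single_apply]

variable (D : FactorDecomposition F A B)
include D

lemma ext {x y : A} (h : ∀ i, D.proj i x = D.proj i y) : x = y := by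
  rw [← D.sum_incl_proj x, ← D.sum_incl_proj y]
  exact Finset.sum_congr rfl fun i _ => by rw [h]

lemma incl_apply_mul (i : Fin m) (b c : B i) :
    D.incl i (b * c) = D.incl i b * D.incl i c := by
  rw [D.incl_mul, D.proj_incl]

lemma incl_central {i : Fin m} {z : B i} (hz : ∀ y, z * y = y * z) (x : A) :
    D.incl i z * x = x * D.incl i z := by
  rw [D.incl_mul, D.mul_incl, hz]

lemma mem_commutatorSpan_iff {x : A} :
    x ∈ commutatorSpan F A ↔ ∀ i, D.proj i x ∈ commutatorSpan F (B i) := by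
  refine ⟨fun hx i => map_mem_commutatorSpan (D.proj i).toLinearMap (map_mul (D.proj i)) hx,
    fun h => ?_⟩
  rw [← D.sum_incl_proj x]
  exact sum_mem fun i _ => map_mem_commutatorSpan (D.incl i) (D.incl_apply_mul i) (h i)

/-- The component of a linear map on a factor. -/
def component (T : A →ₗ[F] A) (i : Fin m) : B i →ₗ[F] B i :=
  (D.proj i).toLinearMap ∘ₗ T ∘ₗ D.incl i

lemma component_apply (T : A →ₗ[F] A) (i : Fin m) (b : B i) :
    D.component T i b = D.proj i (T (D.incl i b)) := rfl

variable {T : A →ₗ[F] A} (hZ : ∀ z, (∀ y, z * y = y * z) → ∀ x, T (z * x) = z * T x)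
include hZ

lemma component_proj (i : Fin m) (x : A) : D.component T i (D.proj i x) = D.proj i (T x) := by
  have h : D.incl i (D.proj i x) = D.incl i 1 * x := by rw [D.incl_mul, one_mul]
  rw [component_apply, h, hZ _ (D.incl_central fun y => by rw [one_mul, mul_one]), map_mul,
    D.proj_incl, one_mul]

lemma component_central_mul (i : Fin m) (z : B i) (hz : ∀ y, z * y = y * z) (x : B i) :
    D.component T i (z * x) = z * D.component T i x := by
  rw [component_apply, D.incl_apply_mul, hZ _ (D.incl_central hz), map_mul, D.proj_incl,
    component_apply]

variable [∀ i, FiniteDimensional F (B i)] [∀ i, IsSimpleRing (B i)]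

lemma exists_sum_mul_mul_s10 : ∃ (n : ℕ) (a b : Fin n → A), ∀ x, T x = ∑ i, a i * x * b i := by
  choose n a b hab using fun i => IsSimpleRing.exists_sum_mul_mul_s10 (D.component_central_mul hZ i)
  let u : (Σ i, Fin (n i)) → A := fun p => D.incl p.1 (a p.1 p.2)
  let v : (Σ i, Fin (n i)) → A := fun p => D.incl p.1 (b p.1 p.2)
  refine ⟨∑ i, n i, u ∘ finSigmaFinEquiv.symm, v ∘ finSigmaFinEquiv.symm, fun x => ?_⟩
  rw [← finSigmaFinEquiv.sum_comp, Fintype.sum_sigma]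
  simp only [Function.comp_apply, Equiv.symm_apply_apply]
  conv_lhs => rw [← D.sum_incl_proj (T x)]
  refine Finset.sum_congr rfl fun i _ => ?_
  rw [← D.component_proj hZ, hab, map_sum]
  refine Finset.sum_congr rfl fun j _ => ?_
  rw [D.incl_mul, D.incl_mul, D.proj_incl]

lemma jordan_sub_self_mem_commutatorSpan (h2 : (2 : F) ≠ 0) (hs : Function.Surjective T)
    (hT : ∀ x y, T (x * y + y * x) = T x * T y + T y * T x) (x : A) :
    T x - x ∈ commutatorSpan F A := by
  rw [D.mem_commutatorSpan_iff]
  intro i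
  have hc := D.component_proj hZ i
  rw [map_sub, ← hc]
  refine IsSimpleRing.jordan_sub_self_mem_commutatorSpan h2 (D.component_central_mul hZ i)
    ?_ ?_ _
  · intro b
    obtain ⟨x, hx⟩ := hs (D.incl i b)
    exact ⟨D.proj i x, by rw [hc, hx, D.proj_incl]⟩
  · intro b c
    obtain ⟨x, rfl⟩ : ∃ x, D.proj i x = b := ⟨_, D.proj_incl i b⟩
    obtain ⟨y, rfl⟩ : ∃ y, D.proj i y = c := ⟨_, D.proj_incl i c⟩
    simp only [← map_mul, ← map_add, hc, hT]

lemma map_one_central_and_cube (h2 : (2 : F) ≠ 0)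
    (hT : ∀ x y z, (T x * T y + T y * T x) * T z - (x * y + y * x) * z ∈ commutatorSpan F A) :
    (∀ x, T 1 * x = x * T 1) ∧ T 1 ^ 3 = 1 := by
  have key : ∀ i, (∀ x, D.component T i 1 * x = x * D.component T i 1) ∧
      D.component T i 1 ^ 3 = 1 := by
    intro i
    refine IsSimpleRing.map_one_central_and_cube h2 (D.component_central_mul hZ i) ?_
    intro b c d
    obtain ⟨x, rfl⟩ : ∃ x, D.proj i x = b := ⟨_, D.proj_incl i b⟩
    obtain ⟨y, rfl⟩ : ∃ y, D.proj i y = c := ⟨_, D.proj_incl i c⟩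
    obtain ⟨z, rfl⟩ : ∃ z, D.proj i z = d := ⟨_, D.proj_incl i d⟩
    simpa only [D.component_proj hZ, map_sub, map_mul, map_add] using
      D.mem_commutatorSpan_iff.1 (hT x y z) i
  simp only [← map_one (D.proj _), D.component_proj hZ] at key
  refine ⟨fun x => D.ext fun i => ?_, D.ext fun i => ?_⟩
  · rw [map_mul, map_mul, (key i).1]
  · rw [map_pow, (key i).2]

omit hZ in
lemma eq_zero_of_mul_mem_commutatorSpan {x : A} (hx : ∀ y, x * y ∈ commutatorSpan F A) :
    x = 0 := by
  refine D.ext fun i => ?_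
  rw [map_zero]
  refine IsSimpleRing.eq_zero_of_mul_mem_commutatorSpan (F := F) fun b => ?_
  have := D.mem_commutatorSpan_iff.1 (hx (D.incl i b)) i
  rwa [map_mul, D.proj_incl] at this

end FactorDecomposition

section Nondegenerate

variable {F A : Type*} [Field F] [Ring A] [Algebra F A] [FiniteDimensional F A]
  (h2 : (2 : F) ≠ 0)
  (hnd : ∀ x : A, (∀ y, x * y ∈ commutatorSpan F A) → x = 0)
  {T : A →ₗ[F] A}
  (hT : ∀ x y z, (T x * T y + T y * T x) * T z - (x * y + y * x) * z ∈ commutatorSpan F A)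
include h2 hnd hT

lemma bijective_of_polarized : Function.Bijective T := by
  have hi : Function.Injective T := by
    rw [injective_iff_map_eq_zero]
    intro x hx
    refine hnd x fun y => ?_
    have := hT x 1 y
    rwa [hx, zero_mul, mul_zero, add_zero, zero_mul, zero_sub, mul_one, one_mul, ← two_smul F,
      smul_mul_assoc, neg_mem_iff, Submodule.smul_mem_iff _ h2] at this
  exact ⟨hi, LinearMap.injective_iff_surjective.1 hi⟩

lemma map_central_mul_of_polarized (z : A) (hz : ∀ y, z * y = y * z) (x : A) :
    T (z * x) = z * T x := by
  have hs := (bijective_of_polarized h2 hnd hT).2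
  rw [← sub_eq_zero]
  refine hnd _ fun y => ?_
  obtain ⟨u, hu⟩ := hs 1
  obtain ⟨y, rfl⟩ := hs y
  have h1 := hT u y (z * x)
  have h3 := center_mul_mem_commutatorSpan hz (hT u y x)
  rw [hu, one_mul, mul_one] at h1 h3
  have h4 := sub_mem h1 h3
  have h5 : ((T y + T y) * T (z * x) - (u * y + y * u) * (z * x)) -
      z * ((T y + T y) * T x - (u * y + y * u) * x) =
      (2 : F) • (T y * (T (z * x) - z * T x)) := by
    have e1 : (u * y + y * u) * (z * x) = z * ((u * y + y * u) * x) := by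
      rw [← mul_assoc, ← hz, mul_assoc]
    have e2 : T y * (z * T x) = z * (T y * T x) := by rw [← mul_assoc, ← hz, mul_assoc]
    rw [e1, mul_sub (T y), e2, two_smul]
    noncomm_ring
  rw [h5, Submodule.smul_mem_iff _ h2] at h4
  have h6 := add_mem h4 (commutator_mem_commutatorSpan (F := F) (T (z * x) - z * T x) (T y))
  rwa [add_sub_cancel] at h6

lemma two_mul_jordan_of_polarized (x y : A) :
    2 * (T x * T y + T y * T x) = T (x * y + y * x) * T 1 + T 1 * T (x * y + y * x) := by
  rw [← sub_eq_zero]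
  refine hnd _ fun z => ?_
  obtain ⟨z, rfl⟩ := (bijective_of_polarized h2 hnd hT).2 z
  have h1 := hT x y z
  have h3 := hT (x * y + y * x) 1 z
  have := sub_mem (add_mem h1 h1) h3
  convert this using 1
  noncomm_ring

end Nondegenerate

/-- **Theorem 3.3.** Let `A` be a finite-dimensional semisimple algebra over a field `F`
with `char F ≠ 2, 3`. A linear map `T : A → A` satisfies `T x ^ 3 - x ^ 3 ∈ [A,A]` for
every `x ∈ A` if and only if there exist a Jordan automorphism `J` of `A` lying in the
multiplication algebra of `A` and a central element `α` with `α ^ 3 = 1` such that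
`T x = α * J x` for all `x ∈ A`. -/
theorem cube_commutator_iff_scalar_jordan_aut (F A : Type*) [Field F] [Ring A]
    [Algebra F A] [FiniteDimensional F A] [IsSemisimpleRing A]
    (h2 : (2 : F) ≠ 0) (h3 : (3 : F) ≠ 0) (T : A →ₗ[F] A) :
    (∀ x : A, T x ^ 3 - x ^ 3 ∈
        Submodule.span F {z : A | ∃ u v : A, z = u * v - v * u}) ↔
      ∃ (J : A →ₗ[F] A) (α : A), Function.Bijective J ∧
        (∀ x y : A, J (x * y + y * x) = J x * J y + J y * J x) ∧
        (∃ (n : ℕ) (a b : Fin n → A), ∀ x : A, J x = ∑ i, a i * x * b i) ∧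
        α ∈ Subalgebra.center F A ∧ α ^ 3 = 1 ∧
        ∀ x : A, T x = α * J x := by
  obtain ⟨m, E, d, _, _, _, hd, ⟨e⟩⟩ :=
    IsSemisimpleRing.exists_algEquiv_pi_matrix_divisionRing_finite F A
  have D := FactorDecomposition.ofAlgEquiv e
  constructor
  · intro h
    have hT := polarized_of_cube_mem_commutatorSpan h3 h
    have hnd := fun x => D.eq_zero_of_mul_mem_commutatorSpan (x := x)
    have hbij := bijective_of_polarized h2 hnd hT
    have hZ := map_central_mul_of_polarized h2 hnd hT
    obtain ⟨hc, h1⟩ := D.map_one_central_and_cube hZ h2 hT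
    have hTT := two_mul_jordan_of_polarized h2 hnd hT
    generalize T 1 = c at hc h1 hTT
    have hc2 : ∀ y, c ^ 2 * y = y * c ^ 2 := fun y => by
      rw [pow_two, mul_assoc, hc, mul_assoc, hc, mul_assoc]
    have hcc : c ^ 2 * c = 1 := by rw [← pow_succ, h1]
    have hcc' : c * c ^ 2 = 1 := by rw [← pow_succ', h1]
    have hJT : ∀ x y, T x * T y + T y * T x = c * T (x * y + y * x) := fun x y => by
      refine eq_of_two_mul_eq h2 ?_
      rw [hTT, ← hc, two_mul]
    have hJZ : ∀ z, (∀ y, z * y = y * z) → ∀ x,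
        (LinearMap.mulLeft F (c ^ 2) ∘ₗ T) (z * x) =
          z * (LinearMap.mulLeft F (c ^ 2) ∘ₗ T) x := fun z hz x => by
      simp only [LinearMap.comp_apply, LinearMap.mulLeft_apply, hZ z hz]
      rw [← mul_assoc, ← hz, mul_assoc]
    refine ⟨LinearMap.mulLeft F (c ^ 2) ∘ₗ T, c, ?_, fun x y => ?_, D.exists_sum_mul_mul_s10 hJZ,
      Subalgebra.mem_center_iff.2 fun y => (hc y).symm, h1, fun x => ?_⟩
    · refine Function.Bijective.comp (g := LinearMap.mulLeft F (c ^ 2)) ?_ hbij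
      refine Function.bijective_iff_has_inverse.2 ⟨LinearMap.mulLeft F c, fun x => ?_, fun x => ?_⟩
      · rw [LinearMap.mulLeft_apply, LinearMap.mulLeft_apply, ← mul_assoc, hcc', one_mul]
      · rw [LinearMap.mulLeft_apply, LinearMap.mulLeft_apply, ← mul_assoc, hcc, one_mul]
    · have key : ∀ u v : A, c ^ 2 * u * (c ^ 2 * v) = c * (u * v) := fun u v => by
        rw [hc2 u, mul_assoc u, ← mul_assoc (c ^ 2) (c ^ 2), ← pow_add,
          show c ^ (2 + 2) = c by rw [pow_succ, h1, one_mul], ← mul_assoc, ← hc, mul_assoc]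
      simp only [LinearMap.comp_apply, LinearMap.mulLeft_apply]
      rw [key, key, ← mul_add, hJT, ← mul_assoc, pow_two]
    · rw [LinearMap.comp_apply, LinearMap.mulLeft_apply, ← mul_assoc, hcc', one_mul]
  · rintro ⟨J, α, hbij, hJ, ⟨n, a, b, hab⟩, hα, hα3, hTJ⟩ x
    have hα' := Subalgebra.mem_center_iff.1 hα
    have hZ : ∀ z, (∀ y, z * y = y * z) → ∀ x, J (z * x) = z * J x := fun z hz x => by
      rw [hab, hab, Finset.mul_sum]
      refine Finset.sum_congr rfl fun i _ => ?_
      rw [← mul_assoc, ← mul_assoc, ← mul_assoc, hz (a i)]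
    have hcube : T x ^ 3 = J (x ^ 3) := by
      rw [hTJ, (show Commute α (J x) from (hα' _).symm).mul_pow, hα3, one_mul,
        jordan_map_cube h2 hJ]
    rw [hcube]
    exact D.jordan_sub_self_mem_commutatorSpan hZ h2 hbij.2 hJ (x ^ 3)
end
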